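/- arXiv:2408.03788 — 9 statements merged into one kernel-verified Lean document; each statement's English description precedes it below -/
import Mathlib

section
/- For every integer N ≥ 2, every real ℘ ≥ 1, and every real t ≥ 0, one has (Φ(t))^℘ ≤ exp(℘t) − ∑_{j=0}^{N−2} (℘t)^j/j!. -/
/-- `Φ(t) = exp(t) − ∑_{j=0}^{N−2} t^j/j!`. -/
noncomputable def Phi (N : ℕ) (t : ℝ) : ℝ :=
  Real.exp t - ∑ j ∈ Finset.range (N - 1), t ^ j / (Nat.factorial j)

theorem hasDerivAt_exp_neg_mul_sum_pow_div_factorial (m : ℕ) (t : ℝ) :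
    HasDerivAt (fun x : ℝ ↦ Real.exp (-x) * ∑ j ∈ Finset.range (m + 1), x ^ j / (Nat.factorial j))
      (-(Real.exp (-t) * (t ^ m / (Nat.factorial m)))) t := by
  have hexp : HasDerivAt (fun x : ℝ ↦ Real.exp (-x)) (-Real.exp (-t)) t := by
    simpa using (hasDerivAt_neg t).exp
  induction m with
  | zero => simpa using hexp
  | succ m ih =>
    have hterm := hexp.mul ((hasDerivAt_pow (m + 1) t).div_const ((m + 1).factorial : ℝ))
    have hsum := ih.add hterm
    simp only [Finset.sum_range_succ _ (m + 1), mul_add]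
    refine hsum.congr_deriv ?_
    have hfac : (m.factorial : ℝ) ≠ 0 := by positivity
    rw [Nat.factorial_succ]
    push_cast
    field_simp
    simp

/-- The probability that a Poisson variable is less than `m` decreases with its parameter. -/
theorem antitoneOn_exp_neg_mul_sum_pow_div_factorial (m : ℕ) :
    AntitoneOn (fun x : ℝ ↦ Real.exp (-x) * ∑ j ∈ Finset.range m, x ^ j / (Nat.factorial j))
      (Set.Ici 0) := by
  cases m with
  | zero => simpa using antitoneOn_const
  | succ m =>
    have hderiv := hasDerivAt_exp_neg_mul_sum_pow_div_factorial m
    refine antitoneOn_of_deriv_nonpos (convex_Ici 0)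
      (fun x _ ↦ (hderiv x).continuousAt.continuousWithinAt)
      (fun x _ ↦ (hderiv x).differentiableAt.differentiableWithinAt) fun x hx ↦ ?_
    rw [interior_Ici, Set.mem_Ioi] at hx
    rw [(hderiv x).deriv]
    exact neg_nonpos.mpr (by positivity)

/-- For every integer `N ≥ 2`, every real `℘ ≥ 1` and every real `t ≥ 0`,
`(Φ(t))^℘ ≤ exp(℘t) − ∑_{j=0}^{N−2} (℘t)^j/j!`. -/
theorem stmt_1 (N : ℕ) (hN : 2 ≤ N) (p t : ℝ) (hp : 1 ≤ p) (ht : 0 ≤ t) :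
    Phi N t ^ p ≤
      Real.exp (p * t) - ∑ j ∈ Finset.range (N - 1), (p * t) ^ j / (Nat.factorial j) := by
  -- Write `Φ(x) = exp(x) * (1 - S x)` with `S` antitone and valued in `[0, 1]`.
  set S : ℝ → ℝ :=
    fun x ↦ Real.exp (-x) * ∑ j ∈ Finset.range (N - 1), x ^ j / (Nat.factorial j) with hS
  have hfactor (x : ℝ) : Real.exp x - ∑ j ∈ Finset.range (N - 1), x ^ j / (Nat.factorial j)
      = Real.exp x * (1 - S x) := by
    rw [hS, mul_sub, ← mul_assoc, ← Real.exp_add]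
    simp
  have hS_nonneg : 0 ≤ S t := by positivity
  have hS_le_one : 0 ≤ 1 - S t := by
    have hPhi := sub_nonneg.mpr (Real.sum_le_exp_of_nonneg ht (N - 1))
    rw [hfactor] at hPhi
    exact nonneg_of_mul_nonneg_right hPhi (Real.exp_pos t)
  have htp : t ≤ p * t := le_mul_of_one_le_left ht hp
  have hanti : S (p * t) ≤ S t :=
    antitoneOn_exp_neg_mul_sum_pow_div_factorial (N - 1) ht (ht.trans htp) htp
  rw [Phi, hfactor, hfactor, Real.mul_rpow (Real.exp_pos t).le hS_le_one, ← Real.exp_mul,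
    mul_comm t p]
  gcongr
  calc (1 - S t) ^ p ≤ 1 - S t :=
        Real.rpow_le_self_of_le_one hS_le_one (by linarith) hp
    _ ≤ 1 - S (p * t) := by linarith
end

section
/- For every integer N ≥ 2 and every δ > 0, the functions ℋ₁ and ℋ₂ are differentiable on ℝ and satisfy the identity ℋ₁(s) − (1/N)·ℋ₁'(s)·s + (1/N)·ℋ₂'(s)·s − ℋ₂(s) = (1/N)|s|^N for all s ∈ ℝ. -/
/-- The function `ℋ₁` of the paper. -/
noncomputable def H1 (N : ℕ) (δ : ℝ) (s : ℝ) : ℝ :=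
  if s = 0 then 0
  else if |s| < ((N : ℝ) - 1) * δ then
    -(1 / (N : ℝ)) * |s| ^ N * Real.log (|s| ^ N)
  else
    -(1 / (N : ℝ)) * |s| ^ N * (Real.log ((((N : ℝ) - 1) * δ) ^ N) + N + 1)
      + (N : ℝ) * δ * |s| ^ (N - 1)
      - (((N : ℝ) - 1) * δ) ^ N / ((N : ℝ) * ((N : ℝ) - 1))

/-- The function `ℋ₂` of the paper. -/
noncomputable def H2 (N : ℕ) (δ : ℝ) (s : ℝ) : ℝ :=
  if |s| ≤ ((N : ℝ) - 1) * δ then 0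
  else
    (1 / (N : ℝ)) * |s| ^ N * Real.log (|s| ^ N / (((N : ℝ) - 1) * δ) ^ N)
      + (N : ℝ) * δ * |s| ^ (N - 1)
      - (((N : ℝ) + 1) / (N : ℝ)) * |s| ^ N
      - (((N : ℝ) - 1) * δ) ^ N / ((N : ℝ) * ((N : ℝ) - 1))

open Filter Topology Asymptotics

/-- Freezing a function to the left of a critical point keeps it differentiable there. -/
lemma HasDerivAt.comp_max_of_deriv_eq_zero {f : ℝ → ℝ} {c : ℝ} (hf : HasDerivAt f 0 c) :
    HasDerivAt (fun t => f (max t c)) 0 c := by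
  have hmax : Tendsto (fun t => max t c) (𝓝 c) (𝓝 c) := by
    have h : Continuous fun t : ℝ => max t c := by fun_prop
    simpa using h.tendsto c
  rw [hasDerivAt_iff_isLittleO] at hf ⊢
  simp only [smul_zero, sub_zero, max_self] at hf ⊢
  refine (hf.comp_tendsto hmax).trans_isBigO (IsBigO.of_bound 1 (Eventually.of_forall fun t => ?_))
  simpa using abs_max_sub_max_le_abs t c c

lemma HasDerivAt.differentiable_comp_max {f : ℝ → ℝ} {c : ℝ} (hc : HasDerivAt f 0 c)
    (hf : ∀ t, c < t → DifferentiableAt ℝ f t) : Differentiable ℝ fun t => f (max t c) := by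
  intro t
  rcases lt_trichotomy t c with h | rfl | h
  · refine (differentiableAt_const (f c)).congr_of_eventuallyEq ?_
    filter_upwards [eventually_lt_nhds h] with x hx
    rw [max_eq_right hx.le]
  · exact hc.comp_max_of_deriv_eq_zero.differentiableAt
  · refine (hf t h).congr_of_eventuallyEq ?_
    filter_upwards [eventually_gt_nhds h] with x hx
    rw [max_eq_left hx.le]

/-- The function `|s| ^ N * log s` is differentiable, and its derivative satisfies Euler's
relation. -/
lemma exists_hasDerivAt_abs_pow_mul_log {N : ℕ} (hN : 2 ≤ N) (s : ℝ) :
    ∃ d : ℝ, HasDerivAt (fun x : ℝ => |x| ^ N * Real.log x) d s ∧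
      d * s = N * (|s| ^ N * Real.log s) + |s| ^ N := by
  rcases eq_or_ne s 0 with rfl | hs
  · refine ⟨0, ?_, by simp [show N ≠ 0 by omega]⟩
    obtain ⟨k, rfl⟩ := Nat.exists_eq_add_of_le' hN
    have hg : Continuous fun x : ℝ => |x| ^ k * (x * Real.log x) :=
      (continuous_abs.pow k).mul Real.continuous_mul_log
    have hfac : (fun x : ℝ => |x| ^ (k + 2) * Real.log x)
        = fun x => x * (|x| ^ k * (x * Real.log x)) := by
      funext x
      rw [pow_add, sq_abs]
      ring
    rw [hfac, hasDerivAt_iff_tendsto_slope]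
    have hlim : Tendsto (fun x : ℝ => |x| ^ k * (x * Real.log x)) (𝓝[≠] 0) (𝓝 0) := by
      simpa using (hg.tendsto 0).mono_left nhdsWithin_le_nhds
    refine hlim.congr' ?_
    filter_upwards [self_mem_nhdsWithin] with x hx
    have hx' : x ≠ 0 := hx
    simp only [slope_def_field]
    field_simp
    simp
    ring
  · refine ⟨_, ((hasDerivAt_abs hs).pow N).mul (Real.hasDerivAt_log hs), ?_⟩
    obtain ⟨k, rfl⟩ : ∃ k, N = k + 1 := ⟨N - 1, by omega⟩
    have hsign : (SignType.sign s : ℝ) * s = |s| := sign_mul_self s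
    simp only [Nat.add_sub_cancel, Pi.pow_apply]
    field_simp
    rw [pow_succ]
    linear_combination ((k + 1 : ℕ) : ℝ) * |s| ^ k * Real.log s * hsign

/-- The profile of `H2` beyond the threshold `(N - 1) * δ`, as a function of `|s|`. -/
noncomputable def H2Outer (N : ℕ) (δ : ℝ) (t : ℝ) : ℝ :=
  (1 / (N : ℝ)) * t ^ N * Real.log (t ^ N / (((N : ℝ) - 1) * δ) ^ N)
    + (N : ℝ) * δ * t ^ (N - 1)
    - (((N : ℝ) + 1) / (N : ℝ)) * t ^ N
    - (((N : ℝ) - 1) * δ) ^ N / ((N : ℝ) * ((N : ℝ) - 1))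

section

variable {N : ℕ} {δ : ℝ}

lemma threshold_pos (hN : 2 ≤ N) (hδ : 0 < δ) : 0 < ((N : ℝ) - 1) * δ := by
  have : (2 : ℝ) ≤ N := by exact_mod_cast hN
  exact mul_pos (by linarith) hδ

lemma H2Outer_threshold (hN : 2 ≤ N) (hδ : 0 < δ) : H2Outer N δ (((N : ℝ) - 1) * δ) = 0 := by
  have hc := threshold_pos hN hδ
  obtain ⟨k, rfl⟩ := Nat.exists_eq_add_of_le' hN
  unfold H2Outer
  rw [div_self (pow_pos hc _).ne', Real.log_one]
  have h1 : ((k + 2 : ℕ) : ℝ) - 1 = k + 1 := by push_cast; ring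
  have h2 : k + 2 - 1 = k + 1 := rfl
  rw [h1, h2]
  push_cast
  have : (k : ℝ) + 1 ≠ 0 := by positivity
  have : (k : ℝ) + 2 ≠ 0 := by positivity
  field_simp
  ring

lemma hasDerivAt_H2Outer (hN : 2 ≤ N) (hδ : 0 < δ) {t : ℝ} (ht : 0 < t) :
    HasDerivAt (H2Outer N δ)
      (t ^ (N - 1) * Real.log (t ^ N / (((N : ℝ) - 1) * δ) ^ N) + t ^ (N - 1)
        + (N : ℝ) * δ * (((N : ℝ) - 1) * t ^ (N - 2)) - ((N : ℝ) + 1) * t ^ (N - 1)) t := by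
  have hc := threshold_pos hN hδ
  have hquot : t ^ N / (((N : ℝ) - 1) * δ) ^ N ≠ 0 := by positivity
  have hlog := ((hasDerivAt_pow N t).div_const ((((N : ℝ) - 1) * δ) ^ N)).log hquot
  have h := (((((hasDerivAt_pow N t).const_mul (1 / (N : ℝ))).mul hlog).add
    ((hasDerivAt_pow (N - 1) t).const_mul ((N : ℝ) * δ))).sub
    ((hasDerivAt_pow N t).const_mul (((N : ℝ) + 1) / (N : ℝ)))).sub_const
    ((((N : ℝ) - 1) * δ) ^ N / ((N : ℝ) * ((N : ℝ) - 1)))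
  refine h.congr_deriv ?_
  have hN0 : (N : ℝ) ≠ 0 := by positivity
  have hcast : ((N - 1 : ℕ) : ℝ) = N - 1 := by
    rw [Nat.cast_sub (by omega), Nat.cast_one]
  have hcN : (((N : ℝ) - 1) * δ) ^ N ≠ 0 := by positivity
  rw [hcast, show N - 1 - 1 = N - 2 by omega]
  generalize (((N : ℝ) - 1) * δ) ^ N = C at *
  field_simp

lemma hasDerivAt_H2Outer_threshold (hN : 2 ≤ N) (hδ : 0 < δ) :
    HasDerivAt (H2Outer N δ) 0 (((N : ℝ) - 1) * δ) := by
  have hc := threshold_pos hN hδ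
  refine (hasDerivAt_H2Outer hN hδ hc).congr_deriv ?_
  rw [div_self (pow_pos hc _).ne', Real.log_one, show N - 1 = N - 2 + 1 by omega, pow_succ]
  ring

lemma H2_eq_H2Outer_max (hN : 2 ≤ N) (hδ : 0 < δ) (s : ℝ) :
    H2 N δ s = H2Outer N δ (max |s| (((N : ℝ) - 1) * δ)) := by
  unfold H2
  split_ifs with h
  · rw [max_eq_right h, H2Outer_threshold hN hδ]
  · rw [max_eq_left (not_le.mp h).le, H2Outer]

lemma differentiable_H2 (hN : 2 ≤ N) (hδ : 0 < δ) : Differentiable ℝ (H2 N δ) := by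
  intro s
  have hc := threshold_pos hN hδ
  rcases eq_or_ne s 0 with rfl | hs
  · refine (differentiableAt_const (0 : ℝ)).congr_of_eventuallyEq ?_
    have hnear : ∀ᶠ x : ℝ in 𝓝 0, |x| < ((N : ℝ) - 1) * δ :=
      continuous_abs.continuousAt.eventually_lt_const (by simpa using hc)
    filter_upwards [hnear] with x hx
    simp [H2, hx.le]
  · rw [funext (H2_eq_H2Outer_max hN hδ)]
    have hG : Differentiable ℝ fun t => H2Outer N δ (max t (((N : ℝ) - 1) * δ)) :=
      (hasDerivAt_H2Outer_threshold hN hδ).differentiable_comp_max fun t ht =>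
        (hasDerivAt_H2Outer hN hδ (hc.trans ht)).differentiableAt
    exact (hG |s|).comp s (hasDerivAt_abs hs).differentiableAt

lemma H1_eq_H2_sub (hN : 2 ≤ N) (hδ : 0 < δ) (s : ℝ) :
    H1 N δ s = H2 N δ s - |s| ^ N * Real.log s := by
  have hc := threshold_pos hN hδ
  have hN0 : (N : ℝ) ≠ 0 := by positivity
  rcases eq_or_ne s 0 with rfl | hs
  · simp [H1, H2, hc.le]
  have hpos : 0 < |s| := abs_pos.mpr hs
  have hlog : Real.log (|s| ^ N) = N * Real.log s := by rw [Real.log_pow, Real.log_abs]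
  by_cases h : |s| < ((N : ℝ) - 1) * δ
  · rw [H1, H2, if_neg hs, if_pos h, if_pos h.le, hlog]
    field_simp
    ring
  · rw [H2_eq_H2Outer_max hN hδ, max_eq_left (not_lt.mp h), H1, if_neg hs, if_neg h, H2Outer,
      Real.log_div (pow_pos hpos _).ne' (pow_pos hc _).ne', hlog]
    generalize Real.log ((((N : ℝ) - 1) * δ) ^ N) = L
    generalize (((N : ℝ) - 1) * δ) ^ N / ((N : ℝ) * ((N : ℝ) - 1)) = K
    field_simp
    ring

end

/-- `H1` and `H2` are differentiable on `ℝ` and satisfy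
`H1(s) - (1/N)*H1'(s)*s + (1/N)*H2'(s)*s - H2(s) = (1/N)|s|^N` for all `s`. -/
theorem stmt_3 (N : ℕ) (hN : 2 ≤ N) (δ : ℝ) (hδ : 0 < δ) :
    (∀ s : ℝ, DifferentiableAt ℝ (H1 N δ) s) ∧
    (∀ s : ℝ, DifferentiableAt ℝ (H2 N δ) s) ∧
    (∀ s : ℝ,
      H1 N δ s - (1 / (N : ℝ)) * deriv (H1 N δ) s * s
        + (1 / (N : ℝ)) * deriv (H2 N δ) s * s - H2 N δ s
        = (1 / (N : ℝ)) * |s| ^ N) := by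
  have hderiv : ∀ s : ℝ, ∃ d : ℝ, HasDerivAt (H1 N δ) (deriv (H2 N δ) s - d) s ∧
      d * s = N * (|s| ^ N * Real.log s) + |s| ^ N := by
    intro s
    obtain ⟨d, hd, hds⟩ := exists_hasDerivAt_abs_pow_mul_log hN s
    refine ⟨d, ?_, hds⟩
    rw [funext (H1_eq_H2_sub hN hδ)]
    exact (differentiable_H2 hN hδ s).hasDerivAt.sub hd
  refine ⟨fun s => ?_, differentiable_H2 hN hδ, fun s => ?_⟩
  · obtain ⟨d, hd, -⟩ := hderiv s
    exact hd.differentiableAt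
  · obtain ⟨d, hd, hds⟩ := hderiv s
    have hN0 : (N : ℝ) ≠ 0 := by positivity
    rw [hd.deriv, H1_eq_H2_sub hN hδ]
    field_simp
    linear_combination hds
end

section
/- For every integer N ≥ 2 there exists δ₀ > 0 such that for every δ ∈ (0, δ₀), the function ℋ₁ is convex on ℝ, even, and continuously differentiable on ℝ. -/
/-- The odd, monotone factor `φ` in the derivative `s ↦ |s| ^ (N - 2) * φ s` of `H1 N δ`, where
`a = (N - 1) * δ`: it is `-N * s * log s - s` on `[-a, a]`, extended affinely. -/
noncomputable def derivFactor (N a s : ℝ) : ℝ :=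
  -N * (max (-a) (min s a) * Real.log (max (-a) (min s a))) - max (-a) (min s a)
    + (s - max (-a) (min s a)) * -(N * Real.log a + N + 1)

lemma derivFactor_of_abs_le {N a s : ℝ} (h : |s| ≤ a) :
    derivFactor N a s = -N * (s * Real.log s) - s := by
  obtain ⟨h₁, h₂⟩ := abs_le.mp h
  simp [derivFactor, h₁, h₂]

lemma derivFactor_of_le {N a s : ℝ} (ha : 0 ≤ a) (h : a ≤ s) :
    derivFactor N a s = -s * (N * Real.log a + N + 1) + N * a := by
  have h₁ : -a ≤ a := by linarith
  simp only [derivFactor, min_eq_right h, max_eq_right h₁]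
  ring

lemma derivFactor_neg {N a : ℝ} (ha : 0 ≤ a) (s : ℝ) :
    derivFactor N a (-s) = -derivFactor N a s := by
  have h : max (-a) (min (-s) a) = -max (-a) (min s a) := by
    rcases le_total s a with h₁ | h₁ <;> rcases le_total (-a) s with h₂ | h₂ <;>
      grind
  simp only [derivFactor, h, Real.log_neg_eq_log]
  ring

lemma continuous_derivFactor (N a : ℝ) : Continuous (derivFactor N a) := by
  have hc : Continuous fun s : ℝ => max (-a) (min s a) := by fun_prop
  have hl := Real.continuous_mul_log.comp hc
  simp only [Function.comp_def] at hl
  unfold derivFactor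
  fun_prop

lemma monotoneOn_derivFactor {N a : ℝ} (hN : 1 ≤ N) (ha : 0 < a) (hlog : Real.log a ≤ -3) :
    MonotoneOn (derivFactor N a) (Set.Ici 0) := by
  have hr : MonotoneOn (fun p : ℝ => -N * (p * Real.log p) - p) (Set.Icc 0 a) := by
    have hl := Real.continuous_mul_log
    refine monotoneOn_of_hasDerivWithinAt_nonneg
      (f' := fun p => -N * (Real.log p + 1) - 1) (convex_Icc 0 a) (by fun_prop) ?_ ?_
    · intro p hp
      rw [interior_Icc] at hp
      exact (((Real.hasDerivAt_mul_log hp.1.ne').const_mul (-N)).sub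
        (hasDerivAt_id p)).hasDerivWithinAt
    · intro p hp
      rw [interior_Icc] at hp
      have := Real.log_le_log hp.1 hp.2.le
      nlinarith
  intro s hs t ht hst
  have hs : 0 ≤ s := hs
  have ht : 0 ≤ t := ht
  have hmax : ∀ x : ℝ, 0 ≤ x → max (-a) (min x a) = min x a := fun x hx =>
    max_eq_right (by linarith [le_min hx ha.le])
  have h₁ := hr ⟨le_min hs ha.le, min_le_right s a⟩ ⟨le_min ht ha.le, min_le_right t a⟩
    (min_le_min_right a hst)
  have h₂ : s - min s a ≤ t - min t a := by grind
  have h₃ : 0 ≤ -(N * Real.log a + N + 1) := by nlinarith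
  simp only [derivFactor, hmax s hs, hmax t ht]
  exact add_le_add h₁ (mul_le_mul_of_nonneg_right h₂ h₃)

lemma monotone_abs_pow_mul_derivFactor {N a : ℝ} (k : ℕ) (hN : 1 ≤ N) (ha : 0 < a)
    (hlog : Real.log a ≤ -3) : Monotone fun s => |s| ^ k * derivFactor N a s := by
  refine monotone_of_odd_of_monotoneOn_nonneg (fun s => ?_) ?_
  · simp [derivFactor_neg ha.le]
  · intro s hs t ht hst
    have hs : 0 ≤ s := hs
    have hφ := monotoneOn_derivFactor hN ha hlog
    have hzero : derivFactor N a 0 = 0 := by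
      simp [derivFactor_of_abs_le (N := N) (s := 0) (a := a) (by simpa using ha.le)]
    have h₀ : 0 ≤ derivFactor N a s := hzero ▸ hφ Set.self_mem_Ici hs hs
    have h₁ : |s| ≤ |t| := abs_le_abs_of_nonneg hs hst
    exact mul_le_mul (pow_le_pow_left₀ (abs_nonneg s) h₁ k) (hφ hs ht hst) h₀ (by positivity)

/-- A local version of `hasDerivAt_of_hasDerivAt_of_ne`. -/
lemma hasDerivAt_of_eventually_hasDerivAt {f g : ℝ → ℝ} {x : ℝ}
    (h : ∀ᶠ y in nhdsWithin x {x}ᶜ, HasDerivAt f (g y) y) (hf : ContinuousAt f x)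
    (hg : ContinuousAt g x) : HasDerivAt f (g x) x := by
  have hr : ∀ᶠ y in nhdsWithin x (Set.Ioi x), HasDerivAt f (g y) y := nhdsGT_le_nhdsNE x h
  have hl : ∀ᶠ y in nhdsWithin x (Set.Iio x), HasDerivAt f (g y) y := nhdsLT_le_nhdsNE x h
  have hdiff : DifferentiableOn ℝ f {y | HasDerivAt f (g y) y} := fun y hy =>
    (HasDerivAt.differentiableAt hy).differentiableWithinAt
  have hIci : HasDerivWithinAt f (g x) (Set.Ici x) x :=
    hasDerivWithinAt_Ici_of_tendsto_deriv hdiff hf.continuousWithinAt hr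
      ((hg.tendsto.mono_left nhdsWithin_le_nhds).congr' (hr.mono fun y hy => hy.deriv.symm))
  have hIic : HasDerivWithinAt f (g x) (Set.Iic x) x :=
    hasDerivWithinAt_Iic_of_tendsto_deriv hdiff hf.continuousWithinAt hl
      ((hg.tendsto.mono_left nhdsWithin_le_nhds).congr' (hl.mono fun y hy => hy.deriv.symm))
  simpa using hIic.union hIci

lemma H1_neg (N : ℕ) (δ s : ℝ) : H1 N δ (-s) = H1 N δ s := by
  simp [H1]

lemma continuous_H1 (k : ℕ) {δ : ℝ} (hδ : 0 < δ) : Continuous (H1 (k + 2) δ) := by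
  have hk : ((k : ℝ) + 1) ≠ 0 := by positivity
  have hk₂ : ((k : ℝ) + 2) ≠ 0 := by positivity
  have ha : 0 < ((k : ℝ) + 1) * δ := by positivity
  have heq : H1 (k + 2) δ = fun s => if (k + 1) * δ ≤ |s| then
      -(1 / ((k : ℝ) + 2)) * |s| ^ (k + 2) * (Real.log (((k + 1) * δ) ^ (k + 2)) + (k + 2) + 1)
      + (k + 2) * δ * |s| ^ (k + 1) - ((k + 1) * δ) ^ (k + 2) / ((k + 2) * (k + 1))
      else -|s| ^ (k + 1) * (|s| * Real.log |s|) := by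
    funext s
    have h₁ : (((k + 2 : ℕ) : ℝ) - 1) = k + 1 := by push_cast; ring
    rcases eq_or_ne s 0 with rfl | hs
    · simp [H1, ha.not_ge]
    · by_cases h : |s| < ((k : ℝ) + 1) * δ
      · simp only [H1, h₁, hs, h, h.not_ge, if_true, if_false, Real.log_pow]
        push_cast
        field_simp
        ring
      · simp only [H1, h₁, hs, h, not_lt.mp h, if_true, if_false]
        push_cast
        rfl
  rw [heq]
  have hl := Real.continuous_mul_log.comp continuous_abs
  simp only [Function.comp_def] at hl
  refine Continuous.if_le (by fun_prop) (by fun_prop) continuous_const continuous_abs ?_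
  intro s hs
  rw [← hs, Real.log_pow]
  push_cast
  field_simp
  ring

lemma hasDerivAt_H1_of_pos_of_ne (k : ℕ) {δ s : ℝ} (hδ : 0 < δ) (hs : 0 < s)
    (hsa : s ≠ (k + 1) * δ) :
    HasDerivAt (H1 (k + 2) δ) (|s| ^ k * derivFactor (k + 2) ((k + 1) * δ) s) s := by
  have hk₂ : ((k : ℝ) + 2) ≠ 0 := by positivity
  have ha : 0 < ((k : ℝ) + 1) * δ := by positivity
  have h₁ : (((k + 2 : ℕ) : ℝ) - 1) = k + 1 := by push_cast; ring
  rcases hsa.lt_or_gt with h | h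
  · have hd := ((hasDerivAt_pow (k + 1) s).mul (Real.hasDerivAt_mul_log hs.ne')).neg
    refine (hd.congr_of_eventuallyEq ?_).congr_deriv ?_
    · filter_upwards [Ioo_mem_nhds hs h] with x hx
      simp only [H1, h₁, hx.1.ne', abs_of_pos hx.1, hx.2, if_true, if_false, Real.log_pow,
        Pi.neg_apply, Pi.mul_apply]
      push_cast
      field_simp
      ring
    · rw [derivFactor_of_abs_le (by rw [abs_of_pos hs]; exact h.le), abs_of_pos hs]
      simp only [Nat.add_sub_cancel]
      push_cast
      ring
  · have hd := (((hasDerivAt_pow (k + 2) s).const_mul (-(1 / ((k : ℝ) + 2)))).mul_const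
      (Real.log (((k + 1) * δ) ^ (k + 2)) + (k + 2) + 1)).add
      ((hasDerivAt_pow (k + 1) s).const_mul (((k : ℝ) + 2) * δ)) |>.sub_const
      (((k + 1) * δ) ^ (k + 2) / (((k : ℝ) + 2) * (k + 1)))
    refine (hd.congr_of_eventuallyEq ?_).congr_deriv ?_
    · filter_upwards [Ioi_mem_nhds h] with x hx
      have hx : ((k : ℝ) + 1) * δ < x := hx
      have hx₀ := ha.trans hx
      simp only [H1, h₁, hx₀.ne', abs_of_pos hx₀, hx.not_gt, if_false, Pi.add_apply]
      push_cast
      rfl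
    · rw [derivFactor_of_le ha.le h.le, abs_of_pos hs, Real.log_pow]
      simp only [Nat.add_sub_cancel, show k + 2 - 1 = k + 1 from rfl]
      push_cast
      field_simp
      ring

lemma hasDerivAt_H1 (k : ℕ) {δ : ℝ} (hδ : 0 < δ) (s : ℝ) :
    HasDerivAt (H1 (k + 2) δ) (|s| ^ k * derivFactor (k + 2) ((k + 1) * δ) s) s := by
  have ha : 0 < ((k : ℝ) + 1) * δ := by positivity
  have hf := continuous_H1 k hδ
  have hφ := continuous_derivFactor (k + 2) (((k : ℝ) + 1) * δ)
  have hg : Continuous fun s => |s| ^ k * derivFactor (k + 2) (((k : ℝ) + 1) * δ) s := by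
    fun_prop
  have hpos : ∀ x : ℝ, 0 < x →
      HasDerivAt (H1 (k + 2) δ) (|x| ^ k * derivFactor (k + 2) ((k + 1) * δ) x) x := by
    intro x hx
    by_cases hxa : x = (k + 1) * δ
    · refine hasDerivAt_of_eventually_hasDerivAt ?_ hf.continuousAt hg.continuousAt
      filter_upwards [nhdsWithin_le_nhds (Ioi_mem_nhds hx), self_mem_nhdsWithin] with y hy hyx
      exact hasDerivAt_H1_of_pos_of_ne k hδ hy (hxa ▸ hyx)
    · exact hasDerivAt_H1_of_pos_of_ne k hδ hx hxa
  have hne : ∀ x : ℝ, x ≠ 0 →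
      HasDerivAt (H1 (k + 2) δ) (|x| ^ k * derivFactor (k + 2) ((k + 1) * δ) x) x := by
    intro x hx
    rcases hx.lt_or_gt with hx | hx
    · have h := (hpos (-x) (neg_pos.mpr hx)).comp x (hasDerivAt_neg x)
      refine (h.congr_of_eventuallyEq (.of_forall fun y => (H1_neg _ δ y).symm)).congr_deriv ?_
      rw [abs_neg, derivFactor_neg ha.le]
      ring
    · exact hpos x hx
  rcases eq_or_ne s 0 with rfl | hs
  · exact hasDerivAt_of_hasDerivAt_of_ne hne hf.continuousAt hg.continuousAt
  · exact hne s hs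

/-- For `δ` small enough, `H1` is convex, even and of class `C¹`. -/
theorem stmt_4 (N : ℕ) (hN : 2 ≤ N) :
    ∃ δ₀ > (0 : ℝ), ∀ δ ∈ Set.Ioo (0 : ℝ) δ₀,
      ConvexOn ℝ Set.univ (H1 N δ) ∧
      (∀ s : ℝ, H1 N δ (-s) = H1 N δ s) ∧
      ContDiff ℝ 1 (H1 N δ) := by
  obtain ⟨k, rfl⟩ := Nat.exists_eq_add_of_le' hN
  refine ⟨Real.exp (-3) / (k + 1), by positivity, fun δ hδ => ?_⟩
  have hδ₀ : 0 < δ := hδ.1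
  have ha : 0 < ((k : ℝ) + 1) * δ := by positivity
  have hlog : Real.log (((k : ℝ) + 1) * δ) ≤ -3 := by
    rw [Real.log_le_iff_le_exp ha, mul_comm]
    exact ((lt_div_iff₀ (by positivity)).mp hδ.2).le
  have hd := hasDerivAt_H1 k hδ₀
  have hderiv := deriv_eq hd
  have hdiff : Differentiable ℝ (H1 (k + 2) δ) := fun s => (hd s).differentiableAt
  refine ⟨Monotone.convexOn_univ_of_deriv hdiff ?_, H1_neg _ δ, ?_⟩
  · rw [hderiv]
    exact monotone_abs_pow_mul_derivFactor k (by linarith [k.cast_nonneg (α := ℝ)]) ha hlog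
  · rw [contDiff_one_iff_deriv, hderiv]
    have hφ := continuous_derivFactor (k + 2) (((k : ℝ) + 1) * δ)
    exact ⟨hdiff, by fun_prop⟩
end

section
/- For every integer N ≥ 2 there exists δ₀ > 0 such that for every δ ∈ (0, δ₀), one has ℋ₁(s) ≥ 0 and ℋ₁'(s)·s ≥ 0 for all s ∈ ℝ. -/
/-- `x ↦ -x log x` is monotone on `[0, e⁻¹]`. -/
lemma Real.monotoneOn_negMulLog : MonotoneOn Real.negMulLog (Set.Icc 0 (Real.exp (-1))) := by
  refine monotoneOn_of_deriv_nonneg (convex_Icc _ _) Real.continuous_negMulLog.continuousOn ?_ ?_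
  · intro x hx
    rw [interior_Icc] at hx
    exact (Real.differentiableAt_negMulLog hx.1.ne').differentiableWithinAt
  · intro x hx
    rw [interior_Icc] at hx
    rw [Real.deriv_negMulLog hx.1.ne']
    have := (Real.log_lt_iff_lt_exp hx.1).2 hx.2
    linarith

/-- Up to and including the breakpoint `(N - 1) δ`, the function `H1` is `negMulLog (s ^ N) / N`. -/
lemma H1_eq_negMulLog {N : ℕ} (hN : 2 ≤ N) {δ s : ℝ} (h0 : 0 ≤ s) (hs : s ≤ ((N : ℝ) - 1) * δ) :
    H1 N δ s = Real.negMulLog (s ^ N) / N := by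
  have hN' : (2 : ℝ) ≤ N := by exact_mod_cast hN
  have hN1 : (N : ℝ) - 1 ≠ 0 := by linarith
  rcases h0.eq_or_lt with rfl | h0
  · simp [H1, show N ≠ 0 by omega]
  rw [H1, if_neg h0.ne', abs_of_pos h0, Real.negMulLog]
  split_ifs with h
  · ring
  · obtain rfl : s = ((N : ℝ) - 1) * δ := le_antisymm hs (not_lt.1 h)
    obtain ⟨m, rfl⟩ : ∃ m, N = m + 1 := ⟨N - 1, by omega⟩
    generalize Real.log _ = L
    rw [Nat.add_sub_cancel]
    field_simp
    push_cast
    ring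

lemma monotoneOn_H1 {N : ℕ} (hN : 2 ≤ N) {δ : ℝ} (hδ : 0 < δ)
    (hlog : Real.log ((((N : ℝ) - 1) * δ) ^ N) ≤ -((N : ℝ) + 1)) :
    MonotoneOn (H1 N δ) (Set.Ici 0) := by
  have hN' : (2 : ℝ) ≤ N := by exact_mod_cast hN
  have ha : 0 < ((N : ℝ) - 1) * δ := mul_pos (by linarith) hδ
  rw [← Set.Icc_union_Ici_eq_Ici ha.le]
  refine MonotoneOn.union_right ?_ ?_ (isGreatest_Icc ha.le) isLeast_Ici
  · have hpow : (((N : ℝ) - 1) * δ) ^ N ≤ Real.exp (-1) :=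
      (Real.log_le_iff_le_exp (pow_pos ha N)).1 (by linarith)
    have hmem : ∀ x ∈ Set.Icc 0 (((N : ℝ) - 1) * δ), x ^ N ∈ Set.Icc 0 (Real.exp (-1)) :=
      fun x hx => ⟨pow_nonneg hx.1 N, (pow_le_pow_left₀ hx.1 hx.2 N).trans hpow⟩
    intro x hx y hy hxy
    rw [H1_eq_negMulLog hN hx.1 hx.2, H1_eq_negMulLog hN hy.1 hy.2]
    gcongr
    exact Real.monotoneOn_negMulLog (hmem x hx) (hmem y hy) (pow_le_pow_left₀ hx.1 hxy N)
  · intro x hx y hy hxy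
    have hx0 : 0 < x := ha.trans_le hx
    have hy0 : 0 < y := ha.trans_le hy
    rw [H1, H1, if_neg hx0.ne', if_neg hy0.ne', abs_of_pos hx0, abs_of_pos hy0,
      if_neg (not_lt.2 hx), if_neg (not_lt.2 hy)]
    generalize Real.log _ = L at hlog
    have h1 : 1 / (N : ℝ) * x ^ N * (-(L + N + 1)) ≤ 1 / (N : ℝ) * y ^ N * (-(L + N + 1)) := by
      have : 0 ≤ -(L + N + 1) := by linarith
      gcongr
    have h2 : (N : ℝ) * δ * x ^ (N - 1) ≤ (N : ℝ) * δ * y ^ (N - 1) := by gcongr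
    linarith

/-- For `δ` small enough, `H1 s ≥ 0` and `H1'(s) * s ≥ 0` for all `s`. -/
theorem stmt_5 (N : ℕ) (hN : 2 ≤ N) :
    ∃ δ₀ > (0 : ℝ), ∀ δ ∈ Set.Ioo (0 : ℝ) δ₀, ∀ s : ℝ,
      0 ≤ H1 N δ s ∧ 0 ≤ deriv (H1 N δ) s * s := by
  have hN' : (2 : ℝ) ≤ N := by exact_mod_cast hN
  have hN1 : 0 < (N : ℝ) - 1 := by linarith
  refine ⟨Real.exp (-((N : ℝ) + 1)) / (N - 1), by positivity, fun δ hδ s => ?_⟩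
  have hlog : Real.log ((((N : ℝ) - 1) * δ) ^ N) ≤ -((N : ℝ) + 1) := by
    have h : Real.log (((N : ℝ) - 1) * δ) ≤ -((N : ℝ) + 1) := by
      rw [Real.log_le_iff_le_exp (mul_pos hN1 hδ.1), mul_comm]
      exact ((lt_div_iff₀ hN1).1 hδ.2).le
    rw [Real.log_pow]
    nlinarith
  have hmono := monotoneOn_H1 hN hδ.1 hlog
  have hanti : AntitoneOn (H1 N δ) (Set.Iic 0) := fun x hx y hy hxy => by
    rw [← H1_neg N δ x, ← H1_neg N δ y]
    exact hmono (Set.mem_Ici.2 (neg_nonneg.2 hy)) (Set.mem_Ici.2 (neg_nonneg.2 hx)) (neg_le_neg hxy)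
  have hzero : H1 N δ 0 = 0 := if_pos rfl
  rcases lt_trichotomy s 0 with hs | rfl | hs
  · refine ⟨hzero ▸ hanti hs.le Set.self_mem_Iic hs.le, mul_nonneg_of_nonpos_of_nonpos ?_ hs.le⟩
    rw [← derivWithin_of_mem_nhds (Iic_mem_nhds hs)]
    exact hanti.derivWithin_nonpos
  · simp [hzero]
  · refine ⟨hzero ▸ hmono Set.self_mem_Ici hs.le hs.le, mul_nonneg ?_ hs.le⟩
    rw [← derivWithin_of_mem_nhds (Ici_mem_nhds hs)]
    exact hmono.derivWithin_nonneg
end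

section
/- For every integer N ≥ 2 and every δ > 0, the function ℋ₂ is twice continuously differentiable on ℝ, and for every q > N there exists a constant C > 0 such that |ℋ₂'(s)| ≤ C|s|^{q−1} and |ℋ₂(s)| ≤ C|s|^q for all s ∈ ℝ. -/
/-- If the derivative of `F` vanishes at `a`, freezing `F` to the left of `a` keeps it
differentiable. -/
lemma hasDerivAt_comp_max {F G : ℝ → ℝ} {a : ℝ} (hF : ∀ t, a ≤ t → HasDerivAt F (G t) t)
    (hG : G a = 0) (s : ℝ) : HasDerivAt (fun x => F (max x a)) (G (max s a)) s := by
  rcases lt_trichotomy s a with h | rfl | h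
  · rw [max_eq_right h.le, hG]
    refine (hasDerivAt_const s (F a)).congr_of_eventuallyEq ?_
    filter_upwards [Iio_mem_nhds h] with x hx
    rw [max_eq_right (le_of_lt hx)]
  · rw [max_self, hG, ← hasDerivWithinAt_univ, ← Set.Iic_union_Ici (a := s)]
    refine HasDerivWithinAt.union ?_ ?_
    · exact (hasDerivWithinAt_const s _ (F s)).congr
        (fun x hx => by rw [max_eq_right hx]) (by rw [max_self])
    · have h := (hF s le_rfl).hasDerivWithinAt (s := Set.Ici s)
      rw [hG] at h
      exact h.congr (fun x hx => by rw [max_eq_left hx]) (by rw [max_self])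
  · rw [max_eq_left h.le]
    refine (hF s h.le).congr_of_eventuallyEq ?_
    filter_upwards [Ioi_mem_nhds h] with x hx
    rw [max_eq_left (le_of_lt hx)]

/-- The formula for `H2 (n + 2) δ` on `[a, ∞)`, where `a = (n + 1) * δ`. -/
noncomputable def outerH2 (n : ℕ) (a t : ℝ) : ℝ :=
  t ^ (n + 2) * Real.log (t / a) + ((n : ℝ) + 2) / (n + 1) * a * t ^ (n + 1)
    - ((n : ℝ) + 3) / (n + 2) * t ^ (n + 2) - a ^ (n + 2) / (((n : ℝ) + 2) * (n + 1))

/-- The first derivative of `outerH2`. -/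
noncomputable def outerH2Deriv (n : ℕ) (a t : ℝ) : ℝ :=
  ((n : ℝ) + 2) * (t ^ n * (t * Real.log (t / a) - t + a))

/-- The second derivative of `outerH2`. -/
noncomputable def outerH2Deriv2 (n : ℕ) (a t : ℝ) : ℝ :=
  ((n : ℝ) + 2) * (n * t ^ (n - 1) * (t * Real.log (t / a) - t + a) + t ^ n * Real.log (t / a))

lemma hasDerivAt_log_div_const {a t : ℝ} (ha : 0 < a) (ht : 0 < t) :
    HasDerivAt (fun x => Real.log (x / a)) (1 / t) t := by
  refine (((hasDerivAt_id' t).div_const a).log (div_pos ht ha).ne').congr_deriv ?_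
  field_simp

lemma hasDerivAt_outerH2 (n : ℕ) {a t : ℝ} (ha : 0 < a) (ht : 0 < t) :
    HasDerivAt (outerH2 n a) (outerH2Deriv n a t) t := by
  have h := ((((hasDerivAt_pow (n + 2) t).mul (hasDerivAt_log_div_const ha ht)).add
    ((hasDerivAt_pow (n + 1) t).const_mul (((n : ℝ) + 2) / (n + 1) * a))).sub
    ((hasDerivAt_pow (n + 2) t).const_mul (((n : ℝ) + 3) / (n + 2)))).sub_const
    (a ^ (n + 2) / (((n : ℝ) + 2) * (n + 1)))
  refine h.congr_deriv ?_
  simp only [outerH2Deriv, Nat.add_sub_cancel, show n + 2 - 1 = n + 1 from rfl]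
  push_cast
  field_simp
  ring

lemma hasDerivAt_outerH2Deriv (n : ℕ) {a t : ℝ} (ha : 0 < a) (ht : 0 < t) :
    HasDerivAt (outerH2Deriv n a) (outerH2Deriv2 n a t) t := by
  have h := ((hasDerivAt_pow n t).mul ((((hasDerivAt_id t).mul
    (hasDerivAt_log_div_const ha ht)).sub (hasDerivAt_id t)).add_const a)).const_mul ((n : ℝ) + 2)
  refine h.congr_deriv ?_
  simp only [outerH2Deriv2, id, Pi.mul_apply, Pi.sub_apply]
  field_simp
  ring

lemma outerH2_self (n : ℕ) {a : ℝ} (ha : 0 < a) : outerH2 n a a = 0 := by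
  simp only [outerH2, div_self ha.ne', Real.log_one]
  field_simp
  ring

lemma outerH2Deriv_self (n : ℕ) {a : ℝ} (ha : 0 < a) : outerH2Deriv n a a = 0 := by
  simp [outerH2Deriv, div_self ha.ne']

lemma outerH2Deriv2_self (n : ℕ) {a : ℝ} (ha : 0 < a) : outerH2Deriv2 n a a = 0 := by
  simp [outerH2Deriv2, div_self ha.ne']

lemma hasDerivAt_outerH2_max (n : ℕ) {a : ℝ} (ha : 0 < a) (s : ℝ) :
    HasDerivAt (fun x => outerH2 n a (max x a)) (outerH2Deriv n a (max s a)) s :=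
  hasDerivAt_comp_max (fun _ ht => hasDerivAt_outerH2 n ha (ha.trans_le ht))
    (outerH2Deriv_self n ha) s

lemma contDiff_outerH2_max (n : ℕ) {a : ℝ} (ha : 0 < a) :
    ContDiff ℝ 2 (fun x => outerH2 n a (max x a)) := by
  have h1 := hasDerivAt_outerH2_max n ha
  have h2 : ∀ s, HasDerivAt (fun x => outerH2Deriv n a (max x a))
      (outerH2Deriv2 n a (max s a)) s :=
    hasDerivAt_comp_max (fun _ ht => hasDerivAt_outerH2Deriv n ha (ha.trans_le ht))
      (outerH2Deriv2_self n ha)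
  have hlog : Continuous fun s => Real.log (max s a / a) := by
    refine Continuous.log (by fun_prop) fun s => ?_
    exact (div_pos (ha.trans_le (le_max_right s a)) ha).ne'
  rw [show (2 : WithTop ℕ∞) = 1 + 1 by norm_num, contDiff_succ_iff_deriv]
  refine ⟨fun s => (h1 s).differentiableAt, by simp, ?_⟩
  rw [show deriv _ = _ from funext fun s => (h1 s).deriv, contDiff_one_iff_deriv]
  refine ⟨fun s => (h2 s).differentiableAt, ?_⟩
  rw [show deriv _ = _ from funext fun s => (h2 s).deriv]
  unfold outerH2Deriv2
  fun_prop

lemma H2_eq_outerH2_add (n : ℕ) {δ : ℝ} (hδ : 0 < δ) (s : ℝ) :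
    H2 (n + 2) δ s = outerH2 n ((n + 1) * δ) (max s ((n + 1) * δ))
      + outerH2 n ((n + 1) * δ) (max (-s) ((n + 1) * δ)) := by
  have hcast : (((n + 2 : ℕ) : ℝ) - 1) * δ = (n + 1) * δ := by push_cast; ring
  have ha : 0 < ((n : ℝ) + 1) * δ := by positivity
  have houter : ∀ t : ℝ, (1 / ((n + 2 : ℕ) : ℝ)) * t ^ (n + 2)
        * Real.log (t ^ (n + 2) / (((n : ℝ) + 1) * δ) ^ (n + 2))
      + ((n + 2 : ℕ) : ℝ) * δ * t ^ (n + 2 - 1)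
      - ((((n + 2 : ℕ) : ℝ) + 1) / ((n + 2 : ℕ) : ℝ)) * t ^ (n + 2)
      - (((n : ℝ) + 1) * δ) ^ (n + 2) / (((n + 2 : ℕ) : ℝ) * (((n + 2 : ℕ) : ℝ) - 1))
      = outerH2 n ((n + 1) * δ) t := by
    intro t
    rw [← div_pow, Real.log_pow, outerH2, show n + 2 - 1 = n + 1 from rfl,
      show (((n + 2 : ℕ) : ℝ) - 1) = n + 1 by push_cast; ring]
    push_cast
    field_simp
    ring
  rw [H2, hcast, houter]
  split_ifs with h
  · rw [abs_le] at h
    rw [max_eq_right h.2, max_eq_right (by linarith [h.1]), outerH2_self n ha, add_zero]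
  · rcases lt_abs.1 (not_le.1 h) with h | h
    · rw [max_eq_left h.le, max_eq_right (by linarith), outerH2_self n ha, add_zero,
        abs_of_pos (by linarith)]
    · rw [max_eq_left h.le, max_eq_right (by linarith), outerH2_self n ha, zero_add,
        abs_of_neg (by linarith)]

lemma deriv_H2 (n : ℕ) {δ : ℝ} (hδ : 0 < δ) (s : ℝ) :
    deriv (H2 (n + 2) δ) s = outerH2Deriv n ((n + 1) * δ) (max s ((n + 1) * δ))
      - outerH2Deriv n ((n + 1) * δ) (max (-s) ((n + 1) * δ)) := by
  have ha : 0 < ((n : ℝ) + 1) * δ := by positivity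
  rw [funext (H2_eq_outerH2_add n hδ)]
  have h := (hasDerivAt_outerH2_max n ha s).add
    ((hasDerivAt_outerH2_max n ha (-s)).comp s (hasDerivAt_neg s))
  rw [mul_neg_one, ← sub_eq_add_neg] at h
  exact h.deriv

lemma abs_outerH2Deriv_le (n : ℕ) {a q t : ℝ} (ha : 0 < a) (hq : (n : ℝ) + 2 < q)
    (ht : a ≤ t) :
    |outerH2Deriv n a t| ≤
      (n + 2) / (a ^ (q - (n + 2)) * (q - (n + 2))) * t ^ (q - 1) := by
  have ht0 : 0 < t := ha.trans_le ht
  have hε : 0 < q - (n + 2) := by linarith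
  have hlog : Real.log (t / a) ≤ (t / a) ^ (q - (n + 2)) / (q - (n + 2)) :=
    Real.log_le_rpow_div (div_pos ht0 ha).le hε
  have hlow : 0 ≤ t * Real.log (t / a) - t + a := by
    have h := mul_le_mul_of_nonneg_left
      (Real.one_sub_inv_le_log_of_pos (div_pos ht0 ha)) ht0.le
    rw [inv_div, mul_sub, mul_one, mul_div_cancel₀ _ ht0.ne'] at h
    linarith
  have hsplit : t ^ (q - 1) = t ^ n * t * t ^ (q - (n + 2)) := by
    rw [← pow_succ, ← Real.rpow_natCast, ← Real.rpow_add ht0]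
    congr 1
    push_cast
    ring
  rw [outerH2Deriv, abs_of_nonneg (by positivity)]
  calc ((n : ℝ) + 2) * (t ^ n * (t * Real.log (t / a) - t + a))
      ≤ (n + 2) * (t ^ n * (t * ((t / a) ^ (q - (n + 2)) / (q - (n + 2))))) := by
        gcongr
        linarith [mul_le_mul_of_nonneg_left hlog ht0.le]
    _ = _ := by
        rw [hsplit, Real.div_rpow ht0.le ha.le]
        field_simp

/-- `H2` is twice continuously differentiable and for every real `q > N` there is
`C > 0` with `|H2'(s)| ≤ C|s|^(q-1)` and `|H2 s| ≤ C|s|^q` for all `s`. -/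
theorem stmt_8 (N : ℕ) (hN : 2 ≤ N) (δ : ℝ) (hδ : 0 < δ) :
    ContDiff ℝ 2 (H2 N δ) ∧
    (∀ q : ℝ, (N : ℝ) < q → ∃ C > (0 : ℝ), ∀ s : ℝ,
      |deriv (H2 N δ) s| ≤ C * |s| ^ (q - 1) ∧ |H2 N δ s| ≤ C * |s| ^ q) := by
  obtain ⟨n, rfl⟩ := Nat.exists_eq_add_of_le' hN
  have ha : 0 < ((n : ℝ) + 1) * δ := by positivity
  have hsmooth : ContDiff ℝ 2 (H2 (n + 2) δ) := by
    rw [funext (H2_eq_outerH2_add n hδ)]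
    exact (contDiff_outerH2_max n ha).add ((contDiff_outerH2_max n ha).comp contDiff_neg)
  refine ⟨hsmooth, fun q hq => ?_⟩
  push_cast at hq
  have hε : 0 < q - (n + 2) := by linarith
  have hq1 : 0 < q - 1 := by linarith [(Nat.cast_nonneg n : (0 : ℝ) ≤ n)]
  obtain ⟨C, hC, hbound⟩ : ∃ C > (0 : ℝ), ∀ t, (n + 1) * δ ≤ t →
      |outerH2Deriv n ((n + 1) * δ) t| ≤ C * t ^ (q - 1) :=
    ⟨_, by positivity, fun t => abs_outerH2Deriv_le n ha hq⟩
  have hderiv : ∀ s, |deriv (H2 (n + 2) δ) s| ≤ C * |s| ^ (q - 1) := by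
    intro s
    rw [deriv_H2 n hδ]
    rcases le_or_gt |s| ((n + 1) * δ) with h | h
    · rw [abs_le] at h
      rw [max_eq_right h.2, max_eq_right (by linarith [h.1]), sub_self, abs_zero]
      positivity
    · rcases lt_abs.1 h with h | h
      · rw [max_eq_left h.le, max_eq_right (by linarith), outerH2Deriv_self n ha, sub_zero,
          abs_of_pos (show 0 < s by linarith)]
        exact hbound s h.le
      · rw [max_eq_left h.le, max_eq_right (by linarith), outerH2Deriv_self n ha, zero_sub,
          abs_neg, abs_of_neg (show s < 0 by linarith)]
        exact hbound (-s) h.le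
  refine ⟨C, hC, fun s => ⟨hderiv s, ?_⟩⟩
  have hzero : H2 (n + 2) δ 0 = 0 := by
    rw [H2_eq_outerH2_add n hδ, neg_zero, max_eq_right ha.le, outerH2_self n ha, add_zero]
  have hmvt := (convex_closedBall (0 : ℝ) |s|).norm_image_sub_le_of_norm_deriv_le
    (f := H2 (n + 2) δ) (C := C * |s| ^ (q - 1))
    (fun x _ => hsmooth.differentiable (by norm_num) x)
    (fun x hx => (hderiv x).trans <| by
      have hx' : |x| ≤ |s| := by simpa using hx
      gcongr)
    (Metric.mem_closedBall_self (abs_nonneg s)) (show s ∈ _ by simp)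
  rw [hzero, sub_zero, sub_zero, Real.norm_eq_abs, Real.norm_eq_abs, mul_assoc] at hmvt
  convert hmvt using 2
  rcases eq_or_ne s 0 with rfl | hs
  · simp [Real.zero_rpow (show q ≠ 0 by linarith)]
  · rw [← Real.rpow_add_one (abs_ne_zero.2 hs), sub_add_cancel]
end

section
/- For every integer N ≥ 2 and every δ > 0, the map s ↦ ℋ₂'(s)/s^{N−1} is nondecreasing on (0, ∞) and strictly increasing on ((N−1)δ, ∞). -/
/-- The function `s ↦ log s - log a - 1 + a / s` is strictly increasing on `[a, ∞)`. -/
theorem strictMonoOn_log_sub_log_add_div {a : ℝ} (ha : 0 < a) :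
    StrictMonoOn (fun s : ℝ => Real.log s - Real.log a - 1 + a / s) (Set.Ici a) := by
  intro x hx y hy hxy
  have hx' : a ≤ x := hx
  have hx0 : 0 < x := ha.trans_le hx'
  have hy0 : 0 < y := hx0.trans hxy
  have hlog : Real.log (x / y) < x / y - 1 :=
    Real.log_lt_sub_one_of_pos (by positivity) ((div_lt_one hy0).2 hxy).ne
  rw [Real.log_div hx0.ne' hy0.ne'] at hlog
  have hfrac : a / x - a / y ≤ 1 - x / y := by
    have : 1 - x / y - (a / x - a / y) = (y - x) * (x - a) / (x * y) := by
      field_simp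
    have : 0 ≤ (y - x) * (x - a) / (x * y) :=
      div_nonneg (mul_nonneg (by linarith) (by linarith)) (by positivity)
    linarith
  dsimp only
  linarith

/-- The derivative of `H2` vanishes on `(0, (N-1)δ]`. -/
theorem deriv_H2_eq_zero {N : ℕ} {δ s : ℝ} (hs : 0 < s) (hsa : s ≤ ((N : ℝ) - 1) * δ) :
    deriv (H2 N δ) s = 0 := by
  by_cases hd : DifferentiableAt ℝ (H2 N δ) s
  · have hu : UniqueDiffWithinAt ℝ (Set.Iic s) s := uniqueDiffWithinAt_Iic s
    rw [← hd.derivWithin hu]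
    have hev : H2 N δ =ᶠ[nhdsWithin s (Set.Iic s)] fun _ => 0 := by
      filter_upwards [self_mem_nhdsWithin, mem_nhdsWithin_of_mem_nhds (lt_mem_nhds hs)]
        with x hx hx0
      exact if_pos ((abs_of_pos hx0).trans_le (le_trans hx hsa))
    rw [hev.derivWithin_eq_of_mem Set.self_mem_Iic]
    simp
  · exact deriv_zero_of_not_differentiableAt hd

/-- The quotient `H2'(s)/s^(N-1)` in closed form on `((N-1)δ, ∞)`. -/
theorem deriv_H2_div_pow {N : ℕ} (hN : 2 ≤ N) {δ s : ℝ} (hδ : 0 < δ)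
    (hs : ((N : ℝ) - 1) * δ < s) :
    deriv (H2 N δ) s / s ^ (N - 1) =
      N * (Real.log s - Real.log (((N : ℝ) - 1) * δ) - 1 + ((N : ℝ) - 1) * δ / s) := by
  obtain ⟨n, rfl⟩ := Nat.exists_eq_add_of_le' hN
  have hn : 0 < ((n + 2 : ℕ) : ℝ) - 1 := by push_cast; linarith [n.cast_nonneg (α := ℝ)]
  set a : ℝ := (((n + 2 : ℕ) : ℝ) - 1) * δ with ha_def
  have ha : 0 < a := mul_pos hn hδ
  have hs0 : 0 < s := ha.trans hs
  set M : ℝ := ((n + 2 : ℕ) : ℝ) with hM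
  have hM0 : M ≠ 0 := by positivity
  have hev : H2 (n + 2) δ =ᶠ[nhds s] fun x =>
      x ^ (n + 2) * (Real.log x - Real.log a) + M * δ * x ^ (n + 1)
        - (M + 1) / M * x ^ (n + 2) - a ^ (n + 2) / (M * (M - 1)) := by
    filter_upwards [lt_mem_nhds hs] with x hx
    have hx0 : 0 < x := ha.trans hx
    rw [H2, abs_of_pos hx0, if_neg (not_le.2 hx), ← div_pow, Real.log_pow,
      Real.log_div hx0.ne' ha.ne', ← hM, ← ha_def]
    have : n + 2 - 1 = n + 1 := rfl
    rw [this]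
    field_simp
  have hder := ((((hasDerivAt_pow (n + 2) s).mul
    ((Real.hasDerivAt_log hs0.ne').sub_const (Real.log a))).add
    ((hasDerivAt_pow (n + 1) s).const_mul (M * δ))).sub
    ((hasDerivAt_pow (n + 2) s).const_mul ((M + 1) / M))).sub_const
    (a ^ (n + 2) / (M * (M - 1)))
  rw [(hder.congr_of_eventuallyEq hev).deriv]
  have hcast : ((n + 1 : ℕ) : ℝ) = M - 1 := by rw [hM]; push_cast; ring
  rw [hcast, ← hM]
  simp only [Nat.add_sub_cancel, show n + 2 - 1 = n + 1 from rfl]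
  rw [ha_def]
  field_simp
  ring

/-- The map `s ↦ H2'(s)/s^(N-1)` is nondecreasing on `(0,∞)` and strictly
increasing on `((N-1)δ, ∞)`. -/
theorem stmt_9 (N : ℕ) (hN : 2 ≤ N) (δ : ℝ) (hδ : 0 < δ) :
    MonotoneOn (fun s : ℝ => deriv (H2 N δ) s / s ^ (N - 1)) (Set.Ioi 0) ∧
    StrictMonoOn (fun s : ℝ => deriv (H2 N δ) s / s ^ (N - 1))
      (Set.Ioi (((N : ℝ) - 1) * δ)) := by
  set a : ℝ := ((N : ℝ) - 1) * δ with ha_def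
  have hN' : (2 : ℝ) ≤ N := by exact_mod_cast hN
  have ha : 0 < a := mul_pos (by linarith) hδ
  have hN0 : (0 : ℝ) < N := by linarith
  have hmono := strictMonoOn_log_sub_log_add_div ha
  have hstrict : StrictMonoOn (fun s : ℝ => deriv (H2 N δ) s / s ^ (N - 1)) (Set.Ioi a) := by
    intro x hx y hy hxy
    dsimp only
    rw [deriv_H2_div_pow hN hδ hx, deriv_H2_div_pow hN hδ hy]
    exact mul_lt_mul_of_pos_left
      (hmono (Set.Ioi_subset_Ici_self hx) (Set.Ioi_subset_Ici_self hy) hxy) hN0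
  refine ⟨fun x hx y hy hxy => ?_, hstrict⟩
  rcases lt_or_ge a x with hax | hxa
  · exact hstrict.monotoneOn hax (hax.trans_le hxy) hxy
  dsimp only
  rw [deriv_H2_eq_zero hx hxa, zero_div]
  rcases lt_or_ge a y with hay | hya
  · rw [deriv_H2_div_pow hN hδ hay]
    have h := hmono Set.self_mem_Ici hay.le hay
    simp only [sub_self, div_self ha.ne'] at h
    exact mul_nonneg hN0.le (by linarith)
  · rw [deriv_H2_eq_zero hy hya, zero_div]
end

section
/- For every integer N ≥ 2 there exists δ₀ > 0 such that for every δ ∈ (0, δ₀): the function ℋ₁ is an N-function; ℋ₁ satisfies the Δ₂-condition; and the conjugate function ℋ̃₁ of ℋ₁ also satisfies the Δ₂-condition. -/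
open Real Set Filter Topology

/-- The restriction of `H1 (n + 2) δ` to the half-line `s ≥ 0`, with `a = (n + 1) δ`. -/
noncomputable def powLogGlue (n : ℕ) (a s : ℝ) : ℝ :=
  if s ≤ a then s ^ (n + 1) * negMulLog s
  else (-log a - 1 - 1 / (n + 2)) * s ^ (n + 2) + (n + 2) / (n + 1) * a * s ^ (n + 1)
    - a ^ (n + 2) / ((n + 2) * (n + 1))

/-- The derivative of `powLogGlue n a` on the positive half-line is `s ^ n * slopeFactor n a s`. -/
noncomputable def slopeFactor (n : ℕ) (a s : ℝ) : ℝ :=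
  if s ≤ a then s * (-(n + 2) * log s - 1)
  else (n + 2) * a + (-(n + 2) * log a - (n + 3)) * s

lemma powLogGlue_pieces_agree (n : ℕ) (a : ℝ) :
    a ^ (n + 1) * negMulLog a =
      (-log a - 1 - 1 / (n + 2)) * a ^ (n + 2) + (n + 2) / (n + 1) * a * a ^ (n + 1)
        - a ^ (n + 2) / ((n + 2) * (n + 1)) := by
  have h1 : (n : ℝ) + 1 ≠ 0 := by positivity
  have h2 : (n : ℝ) + 2 ≠ 0 := by positivity
  rw [negMulLog]
  field_simp
  ring

lemma powLogGlue_of_le {n : ℕ} {a s : ℝ} (h : s ≤ a) :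
    powLogGlue n a s = s ^ (n + 1) * negMulLog s := if_pos h

lemma powLogGlue_of_ge {n : ℕ} {a s : ℝ} (h : a ≤ s) :
    powLogGlue n a s =
      (-log a - 1 - 1 / (n + 2)) * s ^ (n + 2) + (n + 2) / (n + 1) * a * s ^ (n + 1)
        - a ^ (n + 2) / ((n + 2) * (n + 1)) := by
  rcases h.eq_or_lt with rfl | h
  · rw [powLogGlue_of_le le_rfl, powLogGlue_pieces_agree]
  · exact if_neg h.not_ge

lemma powLogGlue_zero {n : ℕ} {a : ℝ} (ha : 0 ≤ a) : powLogGlue n a 0 = 0 := by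
  simp [powLogGlue_of_le ha]

lemma H1_eq_powLogGlue (n : ℕ) {δ : ℝ} (hδ : 0 < δ) (s : ℝ) :
    H1 (n + 2) δ s = powLogGlue n ((n + 1) * δ) |s| := by
  have h1 : (n : ℝ) + 1 ≠ 0 := by positivity
  have h2 : (n : ℝ) + 2 ≠ 0 := by positivity
  have ha : (0 : ℝ) ≤ (n + 1) * δ := by positivity
  have hc : ((n + 2 : ℕ) : ℝ) - 1 = n + 1 := by push_cast; ring
  rw [H1, hc]
  split_ifs with h0 hlt
  · simp [h0, powLogGlue_zero ha]
  · rw [powLogGlue_of_le hlt.le, log_pow, negMulLog]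
    push_cast
    field_simp
    ring
  · rw [powLogGlue_of_ge (not_lt.1 hlt), log_pow, show n + 2 - 1 = n + 1 from rfl]
    push_cast
    field_simp
    ring

lemma continuous_powLogGlue (n : ℕ) (a : ℝ) : Continuous (powLogGlue n a) := by
  unfold powLogGlue
  refine Continuous.if_le ?_ (by fun_prop) continuous_id continuous_const ?_
  · exact (continuous_pow _).mul continuous_negMulLog
  · rintro s rfl
    exact powLogGlue_pieces_agree n s

lemma slopeFactor_of_ge {n : ℕ} {a s : ℝ} (h : a ≤ s) :
    slopeFactor n a s = (n + 2) * a + (-(n + 2) * log a - (n + 3)) * s := by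
  rcases h.eq_or_lt with rfl | h
  · rw [slopeFactor, if_pos le_rfl]; ring
  · exact if_neg h.not_ge

lemma hasDerivAt_powLogGlue (n : ℕ) {a s : ℝ} (hs : 0 < s) :
    HasDerivAt (powLogGlue n a) (s ^ n * slopeFactor n a s) s := by
  have h1 : (n : ℝ) + 1 ≠ 0 := by positivity
  have h2 : (n : ℝ) + 2 ≠ 0 := by positivity
  have hlow : s ≤ a → HasDerivWithinAt (powLogGlue n a) (s ^ n * slopeFactor n a s) (Iic a) s := by
    intro h
    have := ((hasDerivAt_pow (n + 1) s).mul (hasDerivAt_negMulLog hs.ne')).hasDerivWithinAt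
      (s := Iic a)
    refine (this.congr (fun x hx => powLogGlue_of_le hx) (powLogGlue_of_le h)).congr_deriv ?_
    rw [slopeFactor, if_pos h, negMulLog]
    push_cast
    ring
  have hhigh : a ≤ s → HasDerivWithinAt (powLogGlue n a) (s ^ n * slopeFactor n a s) (Ici a) s := by
    intro h
    have := ((((hasDerivAt_pow (n + 2) s).const_mul (-log a - 1 - 1 / (n + 2))).add
      ((hasDerivAt_pow (n + 1) s).const_mul ((n + 2) / (n + 1) * a))).sub_const
      (a ^ (n + 2) / ((n + 2) * (n + 1)))).hasDerivWithinAt (s := Ici a)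
    refine (this.congr (fun x hx => powLogGlue_of_ge hx) (powLogGlue_of_ge h)).congr_deriv ?_
    rw [slopeFactor_of_ge h, show n + 2 - 1 = n + 1 from rfl, show n + 1 - 1 = n from rfl]
    push_cast
    field_simp
    ring
  rcases lt_trichotomy s a with h | rfl | h
  · exact (hlow h.le).hasDerivAt (Iic_mem_nhds h)
  · have := (hlow le_rfl).union (hhigh le_rfl)
    rwa [Iic_union_Ici, hasDerivWithinAt_univ] at this
  · exact (hhigh h.le).hasDerivAt (Ici_mem_nhds h)

lemma log_le_neg_ten {a s : ℝ} (hL : log a ≤ -10) (hs : 0 < s) (h : s ≤ a) : log s ≤ -10 :=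
  (log_le_log hs h).trans hL

lemma slopeFactor_nonneg (n : ℕ) {a s : ℝ} (ha : 0 < a) (hL : log a ≤ -10) (hs : 0 < s) :
    0 ≤ slopeFactor n a s := by
  have hn : (0 : ℝ) ≤ n := n.cast_nonneg
  rw [slopeFactor]
  split_ifs with h
  · have := log_le_neg_ten hL hs h
    exact mul_nonneg hs.le (by nlinarith)
  · have : 0 ≤ -(n + 2) * log a - (n + 3) := by nlinarith
    positivity

lemma monotoneOn_slopeFactor (n : ℕ) {a : ℝ} (ha : 0 < a) (hL : log a ≤ -10) :
    MonotoneOn (slopeFactor n a) (Ioi 0) := by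
  have hn : (0 : ℝ) ≤ n := n.cast_nonneg
  rw [← Ioc_union_Ici_eq_Ioi ha]
  refine MonotoneOn.union_right ?_ ?_ (isGreatest_Ioc ha) isLeast_Ici
  · rintro s ⟨hs, hsa⟩ t ⟨ht, hta⟩ hst
    rw [slopeFactor, slopeFactor, if_pos hsa, if_pos hta]
    have hlt := log_le_neg_ten hL ht hta
    have hquot : s * (log t - log s) ≤ t - s := by
      have := mul_le_mul_of_nonneg_left (log_le_sub_one_of_pos (div_pos ht hs)) hs.le
      rw [log_div ht.ne' hs.ne'] at this
      calc s * (log t - log s) ≤ s * (t / s - 1) := this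
        _ = t - s := by field_simp
    nlinarith [mul_nonneg (sub_nonneg.2 hst) (show 0 ≤ -(n + 2) * log t - 1 - (n + 2) by nlinarith)]
  · intro s hs t ht hst
    rw [slopeFactor_of_ge hs, slopeFactor_of_ge ht]
    have : 0 ≤ -(n + 2) * log a - (n + 3) := by nlinarith
    gcongr

lemma monotoneOn_powLogGlue (n : ℕ) {a : ℝ} (ha : 0 < a) (hL : log a ≤ -10) :
    MonotoneOn (powLogGlue n a) (Ici 0) := by
  refine monotoneOn_of_deriv_nonneg (convex_Ici 0) (continuous_powLogGlue n a).continuousOn ?_ ?_ <;>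
    rw [interior_Ici]
  · exact fun s hs => (hasDerivAt_powLogGlue n hs).differentiableAt.differentiableWithinAt
  · intro s hs
    rw [(hasDerivAt_powLogGlue n hs).deriv]
    exact mul_nonneg (pow_nonneg (le_of_lt hs) n) (slopeFactor_nonneg n ha hL hs)

lemma convexOn_powLogGlue (n : ℕ) {a : ℝ} (ha : 0 < a) (hL : log a ≤ -10) :
    ConvexOn ℝ (Ici 0) (powLogGlue n a) := by
  refine MonotoneOn.convexOn_of_deriv (convex_Ici 0) (continuous_powLogGlue n a).continuousOn
    ?_ ?_ <;> rw [interior_Ici]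
  · exact fun s hs => (hasDerivAt_powLogGlue n hs).differentiableAt.differentiableWithinAt
  · intro s hs t ht hst
    rw [(hasDerivAt_powLogGlue n hs).deriv, (hasDerivAt_powLogGlue n ht).deriv]
    exact mul_le_mul (pow_le_pow_left₀ (le_of_lt hs) hst n)
      (monotoneOn_slopeFactor n ha hL hs ht hst) (slopeFactor_nonneg n ha hL hs)
      (pow_nonneg (le_of_lt ht) n)

lemma convexOn_powLogGlue_abs (n : ℕ) {a : ℝ} (ha : 0 < a) (hL : log a ≤ -10) :
    ConvexOn ℝ univ (fun s => powLogGlue n a |s|) := by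
  have himage : (fun s : ℝ => |s|) '' univ = Ici 0 := by
    ext x
    simp only [image_univ, mem_range, mem_Ici]
    exact ⟨by rintro ⟨y, rfl⟩; positivity, fun hx => ⟨x, abs_of_nonneg hx⟩⟩
  have habs : ConvexOn ℝ univ (fun s : ℝ => |s|) := convexOn_univ_norm (E := ℝ)
  refine ConvexOn.comp (f := fun s : ℝ => |s|) (g := powLogGlue n a) ?_ habs ?_ <;> rw [himage]
  · exact convexOn_powLogGlue n ha hL
  · exact monotoneOn_powLogGlue n ha hL

lemma powLogGlue_of_le_eq_pow_mul {n : ℕ} {a s : ℝ} (h : s ≤ a) :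
    powLogGlue n a s = s ^ (n + 2) * -log s := by
  rw [powLogGlue_of_le h, negMulLog]
  ring

lemma le_powLogGlue_of_ge (n : ℕ) {a s : ℝ} (ha : 0 < a) (h : a ≤ s) :
    (-log a - 3 / 2) * s ^ (n + 2) ≤ powLogGlue n a s := by
  have hs : 0 < s := ha.trans_le h
  have hn : (0 : ℝ) ≤ n := n.cast_nonneg
  rw [powLogGlue_of_ge h]
  have hinv : 1 / ((n : ℝ) + 2) ≤ 1 / 2 := by gcongr; linarith
  have hlead : (-log a - 3 / 2) * s ^ (n + 2) ≤ (-log a - 1 - 1 / (n + 2)) * s ^ (n + 2) :=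
    mul_le_mul_of_nonneg_right (by linarith) (by positivity)
  have hrest : a ^ (n + 2) / ((n + 2) * (n + 1)) ≤ (n + 2) / (n + 1) * a * s ^ (n + 1) := by
    have hpow : a ^ (n + 2) ≤ a * s ^ (n + 1) := by
      rw [pow_succ' a (n + 1)]
      gcongr
    have hX : 0 < a * s ^ (n + 1) := by positivity
    calc a ^ (n + 2) / ((n + 2) * (n + 1)) ≤ a * s ^ (n + 1) / ((n + 2) * (n + 1)) := by gcongr
      _ ≤ (n + 2) * (a * s ^ (n + 1)) / (n + 1) := by
        rw [div_le_div_iff₀ (by positivity) (by positivity)]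
        have : (0 : ℝ) ≤ (a * s ^ (n + 1)) * (n + 1) * ((n + 2) * (n + 2) - 1) :=
          mul_nonneg (by positivity) (by nlinarith)
        nlinarith
      _ = (n + 2) / (n + 1) * a * s ^ (n + 1) := by ring
  linarith

lemma powLogGlue_le_of_ge (n : ℕ) {a s : ℝ} (ha : 0 < a) (h : a ≤ s) :
    powLogGlue n a s ≤ (-log a + 1) * s ^ (n + 2) := by
  have hs : 0 < s := ha.trans_le h
  have hn : (0 : ℝ) ≤ n := n.cast_nonneg
  rw [powLogGlue_of_ge h]
  have hcoef : ((n : ℝ) + 2) / (n + 1) ≤ 2 := by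
    rw [div_le_iff₀ (by positivity)]; linarith
  have hmid : (n + 2) / (n + 1) * a * s ^ (n + 1) ≤ 2 * s ^ (n + 2) := by
    calc (n + 2) / (n + 1) * a * s ^ (n + 1) ≤ 2 * s * s ^ (n + 1) := by gcongr
      _ = 2 * s ^ (n + 2) := by ring
  have hinv : 0 ≤ 1 / ((n : ℝ) + 2) * s ^ (n + 2) := by positivity
  have hlast : 0 ≤ a ^ (n + 2) / (((n : ℝ) + 2) * (n + 1)) := by positivity
  linarith

lemma two_mul_pow_le_powLogGlue (n : ℕ) {a s : ℝ} (ha : 0 < a) (hL : log a ≤ -10) (hs : 0 ≤ s) :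
    2 * s ^ (n + 2) ≤ powLogGlue n a s := by
  rcases hs.eq_or_lt with rfl | hs
  · simp [powLogGlue_zero ha.le]
  have hpow : 0 < s ^ (n + 2) := by positivity
  rcases le_total s a with h | h
  · rw [powLogGlue_of_le_eq_pow_mul h]
    nlinarith [log_le_neg_ten hL hs h]
  · nlinarith [le_powLogGlue_of_ge n ha h]

lemma powLogGlue_two_mul_le (n : ℕ) {a s : ℝ} (ha : 0 < a) (hL : log a ≤ -10) (hs : 0 ≤ s) :
    powLogGlue n a (2 * s) ≤ 2 ^ (n + 2) * (-log a + 1) * powLogGlue n a s := by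
  rcases hs.eq_or_lt with rfl | hs
  · simp [powLogGlue_zero ha.le]
  have hlow := two_mul_pow_le_powLogGlue n ha hL hs.le
  have hpow : 0 < s ^ (n + 2) := by positivity
  have hK : 0 ≤ powLogGlue n a s := by linarith
  rw [mul_assoc]
  rcases le_total (2 * s) a with h | h
  · have hlog : log s ≤ log (2 * s) := log_le_log hs (by linarith)
    calc powLogGlue n a (2 * s) = 2 ^ (n + 2) * (s ^ (n + 2) * -log (2 * s)) := by
          rw [powLogGlue_of_le_eq_pow_mul h, mul_pow, mul_assoc]
      _ ≤ 2 ^ (n + 2) * (s ^ (n + 2) * -log s) := by gcongr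
      _ = 2 ^ (n + 2) * powLogGlue n a s := by
          rw [powLogGlue_of_le_eq_pow_mul (by linarith : s ≤ a)]
      _ ≤ 2 ^ (n + 2) * ((-log a + 1) * powLogGlue n a s) := by
          gcongr
          nlinarith
  · calc powLogGlue n a (2 * s) ≤ (-log a + 1) * (2 * s) ^ (n + 2) := powLogGlue_le_of_ge n ha h
      _ = 2 ^ (n + 2) * ((-log a + 1) * s ^ (n + 2)) := by rw [mul_pow]; ring
      _ ≤ 2 ^ (n + 2) * ((-log a + 1) * powLogGlue n a s) := by
          have : 0 ≤ -log a + 1 := by linarith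
          gcongr
          linarith

lemma eight_mul_powLogGlue_le (n : ℕ) {a r : ℝ} (ha : 0 < a) (hL : log a ≤ -10) (hr : 0 ≤ r) :
    8 * powLogGlue n a r ≤ powLogGlue n a (4 * r) := by
  rcases hr.eq_or_lt with rfl | hr
  · simp [powLogGlue_zero ha.le]
  have hpow : 0 < r ^ (n + 2) := by positivity
  have hlog4 : log (4 * r) = log 4 + log r := log_mul (by norm_num) hr.ne'
  have hlog4_le : log 4 ≤ 3 := by
    have := log_le_sub_one_of_pos (show (0 : ℝ) < 4 by norm_num)
    linarith
  have h16 : 16 * r ^ (n + 2) ≤ (4 * r) ^ (n + 2) := by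
    rw [mul_pow]
    gcongr
    have : (1 : ℝ) ≤ 4 ^ n := one_le_pow₀ (by norm_num)
    rw [pow_add]
    linarith
  rcases le_total (4 * r) a with h | h
  · have hr_le : r ≤ a := by linarith
    rw [powLogGlue_of_le_eq_pow_mul h, powLogGlue_of_le_eq_pow_mul hr_le]
    have hlr := log_le_neg_ten hL hr hr_le
    have := mul_le_mul_of_nonneg_right h16 (show 0 ≤ -log (4 * r) by linarith)
    nlinarith
  · have hhigh := le_powLogGlue_of_ge n ha h
    have := mul_le_mul_of_nonneg_right h16 (show 0 ≤ -log a - 3 / 2 by linarith)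
    rcases le_total r a with hra | hra
    · rw [powLogGlue_of_le_eq_pow_mul hra]
      have : log a ≤ log (4 * r) := log_le_log ha h
      nlinarith
    · have := powLogGlue_le_of_ge n ha hra
      nlinarith

lemma bddAbove_range_mul_sub {f : ℝ → ℝ} (hf : ∀ s, 0 ≤ s → 0 ≤ f s)
    (hf2 : ∀ s, 1 ≤ s → s ^ 2 ≤ f s)
    {t : ℝ} (ht : 0 ≤ t) : BddAbove (range fun s : Ici (0 : ℝ) => t * (s : ℝ) - f s) := by
  refine ⟨t + t ^ 2, ?_⟩
  rintro _ ⟨⟨s, hs⟩, rfl⟩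
  simp only
  rcases le_total s 1 with h | h
  · nlinarith [hf s hs]
  · nlinarith [hf2 s h, sq_nonneg (t - s)]

/-- A function `f` with `2 l f(r) ≤ f(l r)` has a conjugate satisfying the Δ₂-condition. -/
lemma conjugate_two_mul_le {f : ℝ → ℝ} {l t : ℝ} (hl : 0 < l)
    (hf : ∀ r, 0 ≤ r → 2 * l * f r ≤ f (l * r))
    (hbdd : BddAbove (range fun s : Ici (0 : ℝ) => t * (s : ℝ) - f s)) :
    ⨆ s : Ici (0 : ℝ), ((2 * t) * (s : ℝ) - f s) ≤
      2 * l * ⨆ s : Ici (0 : ℝ), (t * (s : ℝ) - f s) := by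
  refine ciSup_le ?_
  rintro ⟨s, hs⟩
  have hr : 0 ≤ s / l := div_nonneg hs hl.le
  have hls : l * (s / l) = s := mul_div_cancel₀ s hl.ne'
  have hle := hf _ hr
  rw [hls] at hle
  calc 2 * t * s - f s ≤ 2 * l * (t * (s / l) - f (s / l)) := by
        have : 2 * l * (t * (s / l)) = 2 * t * s := by rw [← hls]; field_simp
        linarith
    _ ≤ _ := mul_le_mul_of_nonneg_left (le_ciSup hbdd ⟨s / l, hr⟩) (by positivity)

lemma tendsto_powLogGlue_div_zero (n : ℕ) {a : ℝ} (ha : 0 < a) :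
    Tendsto (fun s => powLogGlue n a s / s) (𝓝[>] 0) (𝓝 0) := by
  have hcont : Continuous fun s : ℝ => s ^ n * negMulLog s :=
    (continuous_pow n).mul continuous_negMulLog
  have hlim := hcont.tendsto 0
  simp only [negMulLog_zero, mul_zero] at hlim
  refine (hlim.mono_left nhdsWithin_le_nhds).congr' ?_
  filter_upwards [Ioo_mem_nhdsGT ha] with s hs
  have := hs.1.ne'
  rw [powLogGlue_of_le hs.2.le]
  field_simp
  ring

lemma sq_le_powLogGlue (n : ℕ) {a s : ℝ} (ha : 0 < a) (hL : log a ≤ -10) (hs : 1 ≤ s) :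
    s ^ 2 ≤ powLogGlue n a s := by
  have h := two_mul_pow_le_powLogGlue n ha hL (zero_le_one.trans hs)
  have : s ^ 2 ≤ s ^ (n + 2) := pow_le_pow_right₀ hs (by omega)
  nlinarith

lemma tendsto_powLogGlue_div_atTop (n : ℕ) {a : ℝ} (ha : 0 < a) (hL : log a ≤ -10) :
    Tendsto (fun s => powLogGlue n a s / s) atTop atTop := by
  refine tendsto_atTop_mono' atTop ?_ tendsto_id
  filter_upwards [eventually_ge_atTop 1] with s hs
  rw [id, le_div_iff₀ (by linarith), ← sq]
  exact sq_le_powLogGlue n ha hL hs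


/-- For `δ` small enough, `H1` is an N-function and both `H1` and its conjugate
satisfy the Δ₂-condition. -/
theorem stmt_11 (N : ℕ) (hN : 2 ≤ N) :
    ∃ δ₀ > (0 : ℝ), ∀ δ ∈ Set.Ioo (0 : ℝ) δ₀,
      -- `H1` is an N-function:
      (Continuous (H1 N δ) ∧
        (∀ s : ℝ, 0 ≤ H1 N δ s) ∧
        (∀ s : ℝ, H1 N δ (-s) = H1 N δ s) ∧
        ConvexOn ℝ Set.univ (H1 N δ) ∧
        (∀ s : ℝ, H1 N δ s = 0 ↔ s = 0) ∧
        Filter.Tendsto (fun s : ℝ => H1 N δ s / s) (nhdsWithin 0 (Set.Ioi 0)) (nhds 0) ∧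
        Filter.Tendsto (fun s : ℝ => H1 N δ s / s) Filter.atTop Filter.atTop) ∧
      -- `H1` satisfies the Δ₂-condition:
      (∃ c > (0 : ℝ), ∀ s : ℝ, 0 ≤ s → H1 N δ (2 * s) ≤ c * H1 N δ s) ∧
      -- the conjugate `H̃1(t) = sup_{s ≥ 0} (t·s − H1 s)` satisfies the Δ₂-condition:
      (∃ c > (0 : ℝ), ∀ t : ℝ, 0 ≤ t →
        (⨆ s : Set.Ici (0 : ℝ), ((2 * t) * (s : ℝ) - H1 N δ (s : ℝ))) ≤
          c * ⨆ s : Set.Ici (0 : ℝ), (t * (s : ℝ) - H1 N δ (s : ℝ))) := by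
  obtain ⟨n, rfl⟩ : ∃ n, N = n + 2 := ⟨N - 2, by omega⟩
  refine ⟨exp (-10) / (n + 1), by positivity, ?_⟩
  rintro δ ⟨hδ, hδ'⟩
  have hn : (0 : ℝ) < n + 1 := by positivity
  obtain ⟨a, haδ⟩ : ∃ a : ℝ, a = (n + 1) * δ := ⟨_, rfl⟩
  have ha : 0 < a := by rw [haδ]; positivity
  have hL : log a ≤ -10 := by
    rw [log_le_iff_le_exp ha, haδ, mul_comm]
    exact ((lt_div_iff₀ hn).1 hδ').le
  have hH : H1 (n + 2) δ = fun s => powLogGlue n a |s| := by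
    funext s
    rw [haδ, H1_eq_powLogGlue n hδ]
  have hpos : ∀ s, 0 ≤ s → H1 (n + 2) δ s = powLogGlue n a s := fun s hs => by
    rw [hH]; simp only [abs_of_nonneg hs]
  have hlow : ∀ s, 2 * |s| ^ (n + 2) ≤ H1 (n + 2) δ s := fun s => by
    rw [hH]; exact two_mul_pow_le_powLogGlue n ha hL (abs_nonneg s)
  have hnonneg : ∀ s, 0 ≤ H1 (n + 2) δ s := fun s => le_trans (by positivity) (hlow s)
  refine ⟨⟨?_, hnonneg, ?_, ?_, ?_, ?_, ?_⟩, ?_, ?_⟩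
  · rw [hH]
    exact (continuous_powLogGlue n a).comp continuous_abs
  · intro s
    simp only [hH, abs_neg]
  · rw [hH]
    exact convexOn_powLogGlue_abs n ha hL
  · refine fun s => ⟨fun h => ?_, fun h => ?_⟩
    · by_contra hs
      have : 0 < |s| ^ (n + 2) := by positivity
      linarith [hlow s]
    · rw [h, hpos 0 le_rfl, powLogGlue_zero ha.le]
  · refine (tendsto_powLogGlue_div_zero n ha).congr' ?_
    filter_upwards [self_mem_nhdsWithin] with s hs
    rw [hpos s (le_of_lt hs)]
  · refine (tendsto_powLogGlue_div_atTop n ha hL).congr' ?_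
    filter_upwards [eventually_ge_atTop 0] with s hs
    rw [hpos s hs]
  · refine ⟨2 ^ (n + 2) * (-log a + 1), mul_pos (by positivity) (by linarith), fun s hs => ?_⟩
    rw [hpos s hs, hpos (2 * s) (by positivity)]
    exact powLogGlue_two_mul_le n ha hL hs
  · refine ⟨2 * 4, by norm_num, fun t ht => conjugate_two_mul_le (by norm_num) (fun r hr => ?_) ?_⟩
    · rw [hpos r hr, hpos (4 * r) (by positivity)]
      linarith [eight_mul_powLogGlue_le n ha hL hr]
    · refine bddAbove_range_mul_sub (fun s _ => hnonneg s) (fun s hs => ?_) ht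
      rw [hpos s (by linarith)]
      exact sq_le_powLogGlue n ha hL hs
end

section
/- Let N ≥ 2 be an integer, N' = N/(N−1), and let f : ℝ → ℝ be continuous. Suppose there exists α₀ > 0 such that for every τ > 0 there exists κ_τ > 0 with |f(s)| ≤ τ|s|^{N−1} + κ_τ·Φ(α₀|s|^{N'}) for all s ∈ ℝ, and set F(s) = ∫₀^s f(t) dt. Then for every τ > 0, every ϑ > N, and every α > α₀, there exists a constant κ̃ > 0 such that for all s ∈ ℝ: |f(s)| ≤ τ|s|^{N−1} + κ̃|s|^{ϑ−1}·Φ(α|s|^{N'}) and |F(s)| ≤ τ|s|^N + κ̃|s|^ϑ·Φ(α|s|^{N'}). -/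
/-- `Φ` is the tail of the exponential series. -/
lemma Phi_eq_tsum (N : ℕ) (t : ℝ) :
    Phi N t = ∑' j : ℕ, t ^ (j + (N - 1)) / (Nat.factorial (j + (N - 1))) := by
  have h := (Real.summable_pow_div_factorial t).sum_add_tsum_nat_add (N - 1)
  rw [Phi, Real.exp_eq_exp_ℝ, NormedSpace.exp_eq_tsum_div]
  linarith

lemma Phi_nonneg (N : ℕ) {t : ℝ} (ht : 0 ≤ t) : 0 ≤ Phi N t :=
  sub_nonneg.2 (Real.sum_le_exp_of_nonneg ht _)

lemma Phi_le_Phi (N : ℕ) {t u : ℝ} (ht : 0 ≤ t) (htu : t ≤ u) : Phi N t ≤ Phi N u := by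
  have hs (x : ℝ) := (summable_nat_add_iff (N - 1)).2 (Real.summable_pow_div_factorial x)
  rw [Phi_eq_tsum, Phi_eq_tsum]
  exact (hs t).tsum_le_tsum (fun j => by gcongr) (hs u)

lemma Phi_le_pow_mul_exp (N : ℕ) {t : ℝ} (ht : 0 ≤ t) :
    Phi N t ≤ t ^ (N - 1) * Real.exp t := by
  have h := Complex.norm_exp_sub_sum_le_norm_mul_exp (t : ℂ) (N - 1)
  have e : Complex.exp t - ∑ j ∈ Finset.range (N - 1), (t : ℂ) ^ j / (Nat.factorial j)
      = ((Phi N t : ℝ) : ℂ) := by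
    simp [Phi]
  rw [e, Complex.norm_real, Complex.norm_real, Real.norm_of_nonneg ht] at h
  exact (Real.le_norm_self _).trans h

/-- Near zero, `Φ(a r^{N'})` is bounded by a multiple of `r ^ N`. -/
lemma Phi_mul_rpow_le {N : ℕ} (hN : 2 ≤ N) {a r : ℝ} (ha : 0 ≤ a) (hr : 0 ≤ r) (hr1 : r ≤ 1) :
    Phi N (a * r ^ ((N : ℝ) / ((N : ℝ) - 1))) ≤ a ^ (N - 1) * Real.exp a * r ^ N := by
  have hN' : (0 : ℝ) < (N : ℝ) - 1 := by
    have : (2 : ℝ) ≤ N := by exact_mod_cast hN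
    linarith
  have hp : (r ^ ((N : ℝ) / ((N : ℝ) - 1))) ^ (N - 1) = r ^ N := by
    rw [← Real.rpow_mul_natCast hr, Nat.cast_sub (by omega), Nat.cast_one,
      div_mul_cancel₀ _ hN'.ne', Real.rpow_natCast]
  have hle : a * r ^ ((N : ℝ) / ((N : ℝ) - 1)) ≤ a :=
    mul_le_of_le_one_right ha (Real.rpow_le_one hr hr1 (by positivity))
  calc Phi N (a * r ^ ((N : ℝ) / ((N : ℝ) - 1)))
      ≤ (a * r ^ ((N : ℝ) / ((N : ℝ) - 1))) ^ (N - 1)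
          * Real.exp (a * r ^ ((N : ℝ) / ((N : ℝ) - 1))) :=
        Phi_le_pow_mul_exp N (by positivity)
    _ ≤ (a * r ^ ((N : ℝ) / ((N : ℝ) - 1))) ^ (N - 1) * Real.exp a := by gcongr
    _ = a ^ (N - 1) * Real.exp a * r ^ N := by rw [mul_pow, hp]; ring

/-- The growth estimates (3.2) of the paper, derived from (f1). Here
`N' = N/(N−1)` and `F(s) = ∫₀^s f`. -/
theorem stmt_15 (N : ℕ) (hN : 2 ≤ N) (f : ℝ → ℝ) (hf : Continuous f)
    (α₀ : ℝ) (hα₀ : 0 < α₀)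
    (hgrowth : ∀ τ > (0 : ℝ), ∃ κ > (0 : ℝ), ∀ s : ℝ,
      |f s| ≤ τ * |s| ^ (N - 1) + κ * Phi N (α₀ * |s| ^ ((N : ℝ) / ((N : ℝ) - 1)))) :
    ∀ τ > (0 : ℝ), ∀ ϑ : ℝ, (N : ℝ) < ϑ → ∀ α : ℝ, α₀ < α →
      ∃ κ > (0 : ℝ), ∀ s : ℝ,
        |f s| ≤ τ * |s| ^ (N - 1)
            + κ * |s| ^ (ϑ - 1) * Phi N (α * |s| ^ ((N : ℝ) / ((N : ℝ) - 1))) ∧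
        |∫ t in (0 : ℝ)..s, f t| ≤ τ * |s| ^ N
            + κ * |s| ^ ϑ * Phi N (α * |s| ^ ((N : ℝ) / ((N : ℝ) - 1))) := by
  intro τ hτ ϑ hϑ α hα
  have hN2 : (2 : ℝ) ≤ N := by exact_mod_cast hN
  have hN' : (0 : ℝ) ≤ (N : ℝ) / ((N : ℝ) - 1) := div_nonneg (by linarith) (by linarith)
  have hα0 : 0 < α := hα₀.trans hα
  have hϑ1 : 0 ≤ ϑ - 1 := by linarith
  obtain ⟨κ, hκ, hb⟩ := hgrowth (τ / 2) (by positivity)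
  have hC : 0 < κ * (α₀ ^ (N - 1) * Real.exp α₀) := by positivity
  set C := κ * (α₀ ^ (N - 1) * Real.exp α₀) with hCdef
  set δ := min 1 (τ / 2 / C)
  have hδ : 0 < δ := by positivity
  have key : ∀ s : ℝ, |f s| ≤ τ * |s| ^ (N - 1)
      + κ / δ ^ (ϑ - 1) * |s| ^ (ϑ - 1) * Phi N (α * |s| ^ ((N : ℝ) / ((N : ℝ) - 1))) := by
    intro s
    have hΦ : 0 ≤ Phi N (α * |s| ^ ((N : ℝ) / ((N : ℝ) - 1))) := Phi_nonneg N (by positivity)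
    refine (hb s).trans ?_
    rcases le_total |s| δ with h | h
    · have hs1 : |s| ≤ 1 := h.trans (min_le_left _ _)
      have hsC : C * |s| ≤ τ / 2 := by
        rw [← le_div_iff₀' hC]
        exact h.trans (min_le_right _ _)
      have hsmall : κ * Phi N (α₀ * |s| ^ ((N : ℝ) / ((N : ℝ) - 1)))
          ≤ τ / 2 * |s| ^ (N - 1) :=
        calc κ * Phi N (α₀ * |s| ^ ((N : ℝ) / ((N : ℝ) - 1)))
            ≤ κ * (α₀ ^ (N - 1) * Real.exp α₀ * |s| ^ N) := by
              gcongr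
              exact Phi_mul_rpow_le hN hα₀.le (abs_nonneg s) hs1
          _ = C * |s| * |s| ^ (N - 1) := by
              rw [mul_assoc C, mul_pow_sub_one (by omega), hCdef]
              ring
          _ ≤ τ / 2 * |s| ^ (N - 1) := by gcongr
      have : 0 ≤ κ / δ ^ (ϑ - 1) * |s| ^ (ϑ - 1)
          * Phi N (α * |s| ^ ((N : ℝ) / ((N : ℝ) - 1))) := by positivity
      linarith
    · have hκle : κ ≤ κ / δ ^ (ϑ - 1) * |s| ^ (ϑ - 1) := by
        rw [div_mul_eq_mul_div, le_div_iff₀ (by positivity)]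
        gcongr
      have hΦle : Phi N (α₀ * |s| ^ ((N : ℝ) / ((N : ℝ) - 1)))
          ≤ Phi N (α * |s| ^ ((N : ℝ) / ((N : ℝ) - 1))) :=
        Phi_le_Phi N (by positivity) (by gcongr)
      have hτle : τ / 2 * |s| ^ (N - 1) ≤ τ * |s| ^ (N - 1) := by
        gcongr
        linarith
      refine add_le_add hτle ?_
      calc κ * Phi N (α₀ * |s| ^ ((N : ℝ) / ((N : ℝ) - 1)))
          ≤ κ * Phi N (α * |s| ^ ((N : ℝ) / ((N : ℝ) - 1))) := by gcongr
        _ ≤ _ := by gcongr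
  refine ⟨κ / δ ^ (ϑ - 1), by positivity, fun s => ⟨key s, ?_⟩⟩
  have hint := intervalIntegral.norm_integral_le_of_norm_le_const (f := f) (a := 0) (b := s)
    (C := τ * |s| ^ (N - 1)
      + κ / δ ^ (ϑ - 1) * |s| ^ (ϑ - 1) * Phi N (α * |s| ^ ((N : ℝ) / ((N : ℝ) - 1)))) ?_
  · rw [Real.norm_eq_abs, sub_zero] at hint
    refine hint.trans_eq ?_
    have hpow : |s| ^ ϑ = |s| ^ (ϑ - 1) * |s| := by
      rw [← Real.rpow_add_one' (abs_nonneg s) (by linarith), sub_add_cancel]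
    rw [hpow, ← pow_sub_one_mul (by omega : N ≠ 0) |s|]
    ring
  · intro t ht
    have hts : |t| ≤ |s| := by
      simpa using Set.abs_sub_left_of_mem_uIcc (Set.uIoc_subset_uIcc ht)
    have hΦ : 0 ≤ Phi N (α * |t| ^ ((N : ℝ) / ((N : ℝ) - 1))) := Phi_nonneg N (by positivity)
    have hΦle : Phi N (α * |t| ^ ((N : ℝ) / ((N : ℝ) - 1)))
        ≤ Phi N (α * |s| ^ ((N : ℝ) / ((N : ℝ) - 1))) :=
      Phi_le_Phi N (by positivity) (by gcongr)
    refine (key t).trans ?_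
    gcongr
end

section
/- Let N ≥ 2 be an integer, let s > N be real, let Λ ⊆ ℝ^d be a measurable set (with Lebesgue measure), and let u : ℝ^d → ℝ be measurable with 0 < ‖u‖_{L^N(Λ)} < ∞ and ‖u‖_{L^s(Λ)} < ∞. Assume moreover that the function x ↦ |u(x)|^N · log(|u(x)|/‖u‖_{L^N(Λ)}) is integrable on Λ. Then ∫_Λ |u|^N log(|u|/‖u‖_{L^N(Λ)}) dx ≤ (s/(s−N)) · ‖u‖_{L^N(Λ)}^N · log(‖u‖_{L^s(Λ)}/‖u‖_{L^N(Λ)}). -/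
open MeasureTheory

/-- If `|f| ^ p` has positive integral for some `p > 0`, then so does `|f| ^ q`, provided the latter
is integrable. -/
theorem integral_abs_rpow_pos_of_integral_abs_rpow_pos {α : Type*} [MeasurableSpace α]
    {μ : Measure α} {f : α → ℝ} {p q : ℝ} (hp : 0 < p) (hq : 0 < q)
    (hfq : Integrable (fun x => |f x| ^ q) μ) (hpos : 0 < ∫ x, |f x| ^ p ∂μ) :
    0 < ∫ x, |f x| ^ q ∂μ := by
  have hnonneg : ∀ x, 0 ≤ |f x| ^ q := fun x => Real.rpow_nonneg (abs_nonneg _) _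
  refine (integral_nonneg hnonneg).lt_of_ne fun h => hpos.ne' ?_
  have hzero := (integral_eq_zero_iff_of_nonneg hnonneg hfq).1 h.symm
  refine integral_eq_zero_of_ae ?_
  filter_upwards [hzero] with x hx
  have hfx : |f x| = 0 := (Real.rpow_eq_zero (abs_nonneg _) hq.ne').1 hx
  simp [Real.zero_rpow hp.ne', hfx]

/-- The tangent line bound for the logarithm of `(t / c) ^ (q - p)` at `K`, weighted by `t ^ p`. -/
theorem sub_mul_rpow_mul_log_div_le {p q c K t : ℝ} (hp : 0 < p) (hpq : p < q) (hc : 0 < c)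
    (hK : 0 < K) (ht : 0 ≤ t) :
    (q - p) * (t ^ p * Real.log (t / c)) ≤
      (Real.log K - 1) * t ^ p + (c ^ (q - p) * K)⁻¹ * t ^ q := by
  rcases ht.eq_or_lt with rfl | ht
  · simp [Real.zero_rpow hp.ne', Real.zero_rpow (hp.trans hpq).ne']
  have hr : 0 < (t / c) ^ (q - p) := by positivity
  have hlog := Real.log_le_sub_one_of_pos (div_pos hr hK)
  rw [Real.log_div hr.ne' hK.ne', Real.log_rpow (div_pos ht hc), Real.div_rpow ht.le hc.le]
    at hlog
  have htq : t ^ q = t ^ p * t ^ (q - p) := by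
    rw [← Real.rpow_add ht, add_sub_cancel]
  calc (q - p) * (t ^ p * Real.log (t / c))
      = t ^ p * ((q - p) * Real.log (t / c)) := by ring
    _ ≤ t ^ p * (Real.log K + (t ^ (q - p) / c ^ (q - p) / K - 1)) := by
        gcongr
        linarith
    _ = (Real.log K - 1) * t ^ p + (c ^ (q - p) * K)⁻¹ * t ^ q := by
        rw [htq, mul_inv, div_eq_mul_inv, div_eq_mul_inv]
        ring

/-- Logarithmic interpolation inequality on an arbitrary measure space, with real exponents. -/
theorem integral_abs_rpow_mul_log_le {α : Type*} [MeasurableSpace α] {μ : Measure α}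
    {f : α → ℝ} {p q a b : ℝ} (hp : 0 < p) (hpq : p < q)
    (hfp : Integrable (fun x => |f x| ^ p) μ) (hfq : Integrable (fun x => |f x| ^ q) μ)
    (hpos : 0 < ∫ x, |f x| ^ p ∂μ)
    (ha : a = (∫ x, |f x| ^ p ∂μ) ^ (1 / p)) (hb : b = (∫ x, |f x| ^ q ∂μ) ^ (1 / q))
    (hlog : Integrable (fun x => |f x| ^ p * Real.log (|f x| / a)) μ) :
    ∫ x, |f x| ^ p * Real.log (|f x| / a) ∂μ ≤ q / (q - p) * a ^ p * Real.log (b / a) := by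
  have hq : 0 < q := hp.trans hpq
  have hqpos := integral_abs_rpow_pos_of_integral_abs_rpow_pos hp hq hfq hpos
  have ha0 : 0 < a := ha ▸ Real.rpow_pos_of_pos hpos _
  have hb0 : 0 < b := hb ▸ Real.rpow_pos_of_pos hqpos _
  have hap : ∫ x, |f x| ^ p ∂μ = a ^ p := by
    rw [ha, one_div, Real.rpow_inv_rpow hpos.le hp.ne']
  have hbq : ∫ x, |f x| ^ q ∂μ = b ^ q := by
    rw [hb, one_div, Real.rpow_inv_rpow hqpos.le hq.ne']
  have hK : 0 < (b / a) ^ q := by positivity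
  have hint := integral_mono (hlog.const_mul (q - p))
    ((hfp.const_mul (Real.log ((b / a) ^ q) - 1)).add
      (hfq.const_mul (a ^ (q - p) * (b / a) ^ q)⁻¹))
    fun x => sub_mul_rpow_mul_log_div_le hp hpq ha0 hK (abs_nonneg (f x))
  simp only [Pi.add_apply] at hint
  rw [integral_add (hfp.const_mul _) (hfq.const_mul _), integral_const_mul, integral_const_mul,
    integral_const_mul, hap, hbq, Real.log_rpow (div_pos hb0 ha0)] at hint
  have hcoef : (a ^ (q - p) * (b / a) ^ q)⁻¹ * b ^ q = a ^ p := by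
    rw [Real.div_rpow hb0.le ha0.le, Real.rpow_sub ha0]
    field_simp
  rw [hcoef] at hint
  rw [div_mul_eq_mul_div, div_mul_eq_mul_div, le_div_iff₀ (sub_pos.2 hpq)]
  linarith

/-- The logarithmic interpolation inequality of Lemma 3.3:
`∫_Λ |u|^N log(|u|/‖u‖_{L^N(Λ)}) ≤ (s/(s−N)) ‖u‖_{L^N(Λ)}^N log(‖u‖_{L^s(Λ)}/‖u‖_{L^N(Λ)})`. -/
theorem stmt_18 (N : ℕ) (hN : 2 ≤ N) (s : ℝ) (hs : (N : ℝ) < s)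
    (d : ℕ) (Λ : Set (Fin d → ℝ)) (hΛ : MeasurableSet Λ)
    (u : (Fin d → ℝ) → ℝ) (hu : Measurable u)
    (huN : IntegrableOn (fun x => |u x| ^ (N : ℝ)) Λ)
    (hus : IntegrableOn (fun x => |u x| ^ s) Λ)
    (hpos : 0 < ∫ x in Λ, |u x| ^ (N : ℝ))
    (cN cs : ℝ)
    (hcN : cN = (∫ x in Λ, |u x| ^ (N : ℝ)) ^ (1 / (N : ℝ)))
    (hcs : cs = (∫ x in Λ, |u x| ^ s) ^ (1 / s))
    (hlog : IntegrableOn (fun x => |u x| ^ (N : ℝ) * Real.log (|u x| / cN)) Λ) :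
    ∫ x in Λ, |u x| ^ (N : ℝ) * Real.log (|u x| / cN) ≤
      (s / (s - (N : ℝ))) * cN ^ (N : ℝ) * Real.log (cs / cN) := by
  exact integral_abs_rpow_mul_log_le (Nat.cast_pos.2 (by omega)) hs huN hus hpos hcN hcs hlog
end
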